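/- (Comparison principle) Under the standing assumptions with a local driver, let v be a viscosity supersolution and u a viscosity subsolution of the quasi-variational inequality min{ v(t,x) − Mv(t,x), −∂_t v(t,x) − Lv(t,x) − f(t,x, v(t,x), σ^⊤(t,x)∇_x v(t,x)) } = 0 on [0,T) × ℝ^n, v(T,·) = ψ. If u, v ∈ Π^g, then u(t,x) ≤ v(t,x) for all (t,x) ∈ [0,T] × ℝ^n. -/

import Mathlib

open Set Filter Matrix Topology

noncomputable section

/-- The state space `ℝ^n` with the Euclidean norm. -/
abbrev En (n : ℕ) : Type := EuclideanSpace ℝ (Fin n)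

/-- The space `ℝ^d` (values of `σᵀ∇v`). -/
abbrev Ed (d : ℕ) : Type := EuclideanSpace ℝ (Fin d)

/-- Frobenius norm of a matrix. -/
noncomputable def frob {n d : ℕ} (M : Matrix (Fin n) (Fin d) ℝ) : ℝ :=
  Real.sqrt (∑ i, ∑ j, (M i j) ^ 2)

/-- The intervention operator `Mv(t,x) = sup_b { v(t,Γ(t,x,b)) - ℓ(t,x,b) }`. -/
noncomputable def Mop {n : ℕ} {U : Type} [Nonempty U]
    (Γ : ℝ → En n → U → En n) (ℓ : ℝ → En n → U → ℝ)
    (v : ℝ → En n → ℝ) (t : ℝ) (x : En n) : ℝ :=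
  ⨆ b : U, (v t (Γ t x b) - ℓ t x b)

/-- The (parabolic) domain `[0,T] × ℝ^n`. -/
def Strip (n : ℕ) (T : ℝ) : Set (ℝ × En n) := Icc 0 T ×ˢ (univ : Set (En n))

/-- First-order partial derivative `∂g/∂x_i`. -/
noncomputable def pd {n : ℕ} (g : En n → ℝ) (x : En n) (i : Fin n) : ℝ :=
  fderiv ℝ g x (EuclideanSpace.single i 1)

/-- Second-order partial derivative `∂²g/∂x_i∂x_j`. -/
noncomputable def pd2 {n : ℕ} (g : En n → ℝ) (x : En n) (i j : Fin n) : ℝ :=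
  fderiv ℝ (fun y => fderiv ℝ g y (EuclideanSpace.single j 1)) x (EuclideanSpace.single i 1)

/-- The generator `Lφ = Σ_j a_j ∂φ/∂x_j + (1/2) Σ_{i,j} (σσᵀ)_{ij} ∂²φ/∂x_i∂x_j`. -/
noncomputable def genL {n d : ℕ} (a : ℝ → En n → En n)
    (σm : ℝ → En n → Matrix (Fin n) (Fin d) ℝ)
    (φ : ℝ → En n → ℝ) (t : ℝ) (x : En n) : ℝ :=
  (∑ j, a t x j * pd (φ t) x j)
    + (1/2) * ∑ i, ∑ j, (σm t x * (σm t x)ᵀ) i j * pd2 (φ t) x i j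

/-- `σ(t,x)ᵀ ∇_x φ(t,x) ∈ ℝ^d`. -/
noncomputable def sigGrad {n d : ℕ} (σm : ℝ → En n → Matrix (Fin n) (Fin d) ℝ)
    (φ : ℝ → En n → ℝ) (t : ℝ) (x : En n) : Ed d :=
  (WithLp.equiv 2 (Fin d → ℝ)).symm (fun k => ∑ i, σm t x i k * pd (φ t) x i)

/-- Test functions: `C¹` in `t` and `C²` in `x` (jointly `C²`). -/
def IsTest {n : ℕ} (φ : ℝ → En n → ℝ) : Prop :=
  ContDiff ℝ 2 (fun p : ℝ × En n => φ p.1 p.2)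

/-- Time derivative `∂φ/∂t`. -/
noncomputable def ptd {n : ℕ} (φ : ℝ → En n → ℝ) (t : ℝ) (x : En n) : ℝ :=
  deriv (fun s => φ s x) t

/-- Polynomial growth in `x`, uniformly for `t ∈ [0,T]` (the class `Π^g`). -/
def PolyGrowth {n : ℕ} (T : ℝ) (φ : ℝ → En n → ℝ) : Prop :=
  ∃ C > (0:ℝ), ∃ ρ > (0:ℝ), ∀ t ∈ Icc (0:ℝ) T, ∀ x : En n, |φ t x| ≤ C * (1 + ‖x‖ ^ ρ)

/-- The class `Π^g_c`: jointly continuous functions of polynomial growth. -/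
def PGc {n : ℕ} (T : ℝ) (φ : ℝ → En n → ℝ) : Prop :=
  PolyGrowth T φ ∧ ContinuousOn (fun p : ℝ × En n => φ p.1 p.2) (Strip n T)

/-- Locally bounded on `[0,T] × ℝ^n`. -/
def LocBdd {n : ℕ} (T : ℝ) (g : ℝ → En n → ℝ) : Prop :=
  ∀ p ∈ Strip n T, ∃ s ∈ 𝓝 p, ∃ C : ℝ, ∀ q ∈ s ∩ Strip n T, |g q.1 q.2| ≤ C

/-- Viscosity supersolution (local driver `f(t,x,y,z)`). -/
def IsSuper {n d : ℕ} {U : Type} [Nonempty U] (T : ℝ)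
    (Γ : ℝ → En n → U → En n) (ℓ : ℝ → En n → U → ℝ)
    (a : ℝ → En n → En n) (σm : ℝ → En n → Matrix (Fin n) (Fin d) ℝ)
    (f : ℝ → En n → ℝ → Ed d → ℝ) (ψ : En n → ℝ)
    (v : ℝ → En n → ℝ) : Prop :=
  LowerSemicontinuousOn (fun p : ℝ × En n => v p.1 p.2) (Strip n T) ∧
  (∀ x : En n, ψ x ≤ v T x) ∧
  ∀ t ∈ Ico (0:ℝ) T, ∀ x : En n, ∀ φ : ℝ → En n → ℝ, IsTest φ →
    φ t x = v t x →
    IsLocalMaxOn (fun p : ℝ × En n => φ p.1 p.2 - v p.1 p.2) (Strip n T) (t, x) →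
    0 ≤ min (v t x - Mop Γ ℓ v t x)
        (-(ptd φ t x) - genL a σm φ t x - f t x (v t x) (sigGrad σm φ t x))

/-- Viscosity subsolution (local driver `f(t,x,y,z)`). -/
def IsSub {n d : ℕ} {U : Type} [Nonempty U] (T : ℝ)
    (Γ : ℝ → En n → U → En n) (ℓ : ℝ → En n → U → ℝ)
    (a : ℝ → En n → En n) (σm : ℝ → En n → Matrix (Fin n) (Fin d) ℝ)
    (f : ℝ → En n → ℝ → Ed d → ℝ) (ψ : En n → ℝ)
    (u : ℝ → En n → ℝ) : Prop :=
  UpperSemicontinuousOn (fun p : ℝ × En n => u p.1 p.2) (Strip n T) ∧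
  (∀ x : En n, u T x ≤ ψ x) ∧
  ∀ t ∈ Ico (0:ℝ) T, ∀ x : En n, ∀ φ : ℝ → En n → ℝ, IsTest φ →
    φ t x = u t x →
    IsLocalMinOn (fun p : ℝ × En n => φ p.1 p.2 - u p.1 p.2) (Strip n T) (t, x) →
    min (u t x - Mop Γ ℓ u t x)
        (-(ptd φ t x) - genL a σm φ t x - f t x (u t x) (sigGrad σm φ t x)) ≤ 0

/-- Viscosity supersolution (non-local driver `f(t,x,g,z)`, `g ∈ C(ℝ^n,ℝ)`). -/
def IsSuperNL {n d : ℕ} {U : Type} [Nonempty U] (T : ℝ)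
    (Γ : ℝ → En n → U → En n) (ℓ : ℝ → En n → U → ℝ)
    (a : ℝ → En n → En n) (σm : ℝ → En n → Matrix (Fin n) (Fin d) ℝ)
    (f : ℝ → En n → (En n → ℝ) → Ed d → ℝ) (ψ : En n → ℝ)
    (v : ℝ → En n → ℝ) : Prop :=
  LowerSemicontinuousOn (fun p : ℝ × En n => v p.1 p.2) (Strip n T) ∧
  (∀ x : En n, ψ x ≤ v T x) ∧
  ∀ t ∈ Ico (0:ℝ) T, ∀ x : En n, ∀ φ : ℝ → En n → ℝ, IsTest φ →
    φ t x = v t x →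
    IsLocalMaxOn (fun p : ℝ × En n => φ p.1 p.2 - v p.1 p.2) (Strip n T) (t, x) →
    0 ≤ min (v t x - Mop Γ ℓ v t x)
        (-(ptd φ t x) - genL a σm φ t x - f t x (v t) (sigGrad σm φ t x))

/-- Viscosity subsolution (non-local driver `f(t,x,g,z)`). -/
def IsSubNL {n d : ℕ} {U : Type} [Nonempty U] (T : ℝ)
    (Γ : ℝ → En n → U → En n) (ℓ : ℝ → En n → U → ℝ)
    (a : ℝ → En n → En n) (σm : ℝ → En n → Matrix (Fin n) (Fin d) ℝ)
    (f : ℝ → En n → (En n → ℝ) → Ed d → ℝ) (ψ : En n → ℝ)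
    (u : ℝ → En n → ℝ) : Prop :=
  UpperSemicontinuousOn (fun p : ℝ × En n => u p.1 p.2) (Strip n T) ∧
  (∀ x : En n, u T x ≤ ψ x) ∧
  ∀ t ∈ Ico (0:ℝ) T, ∀ x : En n, ∀ φ : ℝ → En n → ℝ, IsTest φ →
    φ t x = u t x →
    IsLocalMinOn (fun p : ℝ × En n => φ p.1 p.2 - u p.1 p.2) (Strip n T) (t, x) →
    min (u t x - Mop Γ ℓ u t x)
        (-(ptd φ t x) - genL a σm φ t x - f t x (u t) (sigGrad σm φ t x)) ≤ 0

theorem le_of_quadratic_increments (g : ℝ → ℝ) (C e : ℝ)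
    (h : ∀ s t, 0 ≤ s → s ≤ t → t ≤ 1 → g t - g s ≤ C * (t - s) ^ 2 + e * (t - s)) :
    g 1 - g 0 ≤ e := by
  have key : ∀ N : ℕ, g 1 - g 0 ≤ C * (1 / ((N : ℝ) + 1)) + e := by
    intro N
    have hN : (0 : ℝ) < (N : ℝ) + 1 := by positivity
    have h1 : ∑ i ∈ Finset.range (N + 1),
        (g (((i + 1 : ℕ) : ℝ) / ((N : ℝ) + 1)) - g ((i : ℝ) / ((N : ℝ) + 1))) = g 1 - g 0 := by
      rw [Finset.sum_range_sub (fun i : ℕ => g ((i : ℝ) / ((N : ℝ) + 1)))]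
      push_cast
      rw [div_self hN.ne']
      simp
    have h2 : ∑ i ∈ Finset.range (N + 1),
        (g (((i + 1 : ℕ) : ℝ) / ((N : ℝ) + 1)) - g ((i : ℝ) / ((N : ℝ) + 1))) ≤
        ∑ i ∈ Finset.range (N + 1),
          (C * (1 / ((N : ℝ) + 1)) ^ 2 + e * (1 / ((N : ℝ) + 1))) := by
      refine Finset.sum_le_sum fun i hi => ?_
      have hi' : (i : ℝ) + 1 ≤ (N : ℝ) + 1 := by
        exact_mod_cast Finset.mem_range.1 hi
      have h3 : ((i + 1 : ℕ) : ℝ) / ((N : ℝ) + 1) - (i : ℝ) / ((N : ℝ) + 1)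
          = 1 / ((N : ℝ) + 1) := by
        push_cast
        field_simp
        ring
      have := h ((i : ℝ) / ((N : ℝ) + 1)) (((i + 1 : ℕ) : ℝ) / ((N : ℝ) + 1)) (by positivity)
        (by rw [← sub_nonneg, h3]; positivity) (by push_cast; rw [div_le_one hN]; exact hi')
      rwa [h3] at this
    rw [h1, Finset.sum_const, Finset.card_range, nsmul_eq_mul] at h2
    refine h2.trans (le_of_eq ?_)
    push_cast
    field_simp
  have lim : Tendsto (fun N : ℕ => C * (1 / ((N : ℝ) + 1)) + e) atTop (𝓝 (C * 0 + e)) :=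
    (tendsto_one_div_add_atTop_nhds_zero_nat.const_mul C).add_const e
  simpa using ge_of_tendsto' lim key

section Subgradient

variable {Z : Type*} [NormedAddCommGroup Z] [InnerProductSpace ℝ Z]
  {F : Z → ℝ} {s : Z → Z}

theorem subgradient_eq_of_le_quadratic (hs : ∀ x y, F x + inner ℝ (s x) (y - x) ≤ F y)
    {z ξ : Z} {C : ℝ} (hC : 0 ≤ C)
    (hz : ∀ h, F (z + h) ≤ F z + inner ℝ ξ h + C * ‖h‖ ^ 2) : s z = ξ := by
  rw [← sub_eq_zero, ← norm_eq_zero]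
  set e := s z - ξ with he
  have h1 : ∀ h, inner ℝ e h ≤ C * ‖h‖ ^ 2 := by
    intro h
    have h2 := hs z (z + h)
    have h3 := hz h
    rw [add_sub_cancel_left] at h2
    rw [he, inner_sub_left]
    linarith
  have h4 := h1 ((1 / (C + 1)) • e)
  rw [inner_smul_right, norm_smul, real_inner_self_eq_norm_sq, mul_pow, Real.norm_eq_abs,
    sq_abs] at h4
  by_contra hne
  have hpos : 0 < ‖e‖ ^ 2 := by positivity
  have h5 : (1 / (C + 1)) * ‖e‖ ^ 2 ≤ (1 / (C + 1)) * ‖e‖ ^ 2 * (C / (C + 1)) := by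
    refine h4.trans (le_of_eq ?_)
    field_simp
  have h6 : C / (C + 1) < 1 := by
    rw [div_lt_one (by positivity)]; linarith
  have h7 : 0 < (1 / (C + 1)) * ‖e‖ ^ 2 := by positivity
  nlinarith

theorem subgradient_lipschitz_at_of_le_quadratic
    (hs : ∀ x y, F x + inner ℝ (s x) (y - x) ≤ F y) {z : Z} {C : ℝ} (hC : 0 ≤ C)
    (hz : ∀ h, F (z + h) ≤ F z + inner ℝ (s z) h + C * ‖h‖ ^ 2) (x : Z) :
    ‖s x - s z‖ ≤ 4 * C * ‖x - z‖ := by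
  set e := s x - s z with he
  set r := ‖x - z‖ with hr
  have hr0 : 0 ≤ r := norm_nonneg _
  have h1 : ∀ k, inner ℝ e k ≤ C * ‖x - z + k‖ ^ 2 := by
    intro k
    have h2 := hs x (x + k)
    have h3 := hz (x - z + k)
    have h4 := hs z x
    rw [add_sub_cancel_left] at h2
    rw [show z + (x - z + k) = x + k by abel, inner_add_right] at h3
    rw [he, inner_sub_left]
    linarith
  rcases eq_or_ne e 0 with h0 | h0
  · rw [h0, norm_zero]; positivity
  have hpos : 0 < ‖e‖ := norm_pos_iff.2 h0
  rcases hr0.eq_or_lt with hr1 | hr1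
  · have : x = z := by
      rw [← sub_eq_zero, ← norm_eq_zero, ← hr, ← hr1]
    simp [he, this] at h0
  have h5 := h1 ((r / ‖e‖) • e)
  have h6 : ‖(r / ‖e‖) • e‖ = r := by
    rw [norm_smul, Real.norm_eq_abs, abs_of_pos (by positivity)]
    field_simp
  have h7 : ‖x - z + (r / ‖e‖) • e‖ ≤ 2 * r := by
    refine (norm_add_le _ _).trans ?_
    rw [h6]; linarith
  rw [inner_smul_right, real_inner_self_eq_norm_sq] at h5
  have h8 : r / ‖e‖ * ‖e‖ ^ 2 = r * ‖e‖ := by field_simp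
  have h9 : C * ‖x - z + (r / ‖e‖) • e‖ ^ 2 ≤ C * (2 * r) ^ 2 := by gcongr
  have h10 : r * ‖e‖ ≤ r * (4 * C * r) := by nlinarith
  exact le_of_mul_le_mul_left h10 hr1

theorem exists_linear_approx_of_resolvent_differentiable [FiniteDimensional ℝ Z]
    {z : Z} {K : ℝ} (hK : 0 ≤ K) (hz : ∀ x, ‖s x - s z‖ ≤ K * ‖x - z‖)
    {J : Z → Z} (hJ : ∀ x, J (x + s x) = x) (hd : DifferentiableAt ℝ J (z + s z)) :
    ∃ A : Z →L[ℝ] Z, ∀ η > 0, ∀ᶠ x in 𝓝 z, ‖s x - s z - A (x - z)‖ ≤ η * ‖x - z‖ := by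
  set M := fderiv ℝ J (z + s z) with hM
  have hT : ∀ x, ‖(x + s x) - (z + s z)‖ ≤ (K + 1) * ‖x - z‖ := by
    intro x
    rw [show (x + s x) - (z + s z) = (x - z) + (s x - s z) by abel]
    refine (norm_add_le _ _).trans ?_
    linarith [hz x]
  have hTc : Tendsto (fun x => x + s x) (𝓝 z) (𝓝 (z + s z)) := by
    rw [tendsto_iff_norm_sub_tendsto_zero]
    refine squeeze_zero (fun _ => norm_nonneg _) hT ?_
    have : Continuous fun x : Z => (K + 1) * ‖x - z‖ := by fun_prop
    simpa using this.tendsto z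
  have hexp : ∀ η > 0, ∀ᶠ x in 𝓝 z,
      ‖x - z - M ((x + s x) - (z + s z))‖ ≤ η * ‖x - z‖ := by
    intro η hη
    have h1 := (hd.hasFDerivAt.isLittleO.def (c := η / (K + 1)) (by positivity))
    filter_upwards [hTc.eventually h1] with x hx
    rw [hJ, hJ] at hx
    refine hx.trans ?_
    calc η / (K + 1) * ‖(x + s x) - (z + s z)‖ ≤ η / (K + 1) * ((K + 1) * ‖x - z‖) := by
          gcongr; exact hT x
      _ = η * ‖x - z‖ := by field_simp
  have hsurj : Function.Surjective M := by
    have hcl : IsClosed ((LinearMap.range (M : Z →ₗ[ℝ] Z) : Submodule ℝ Z) : Set Z) :=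
      Submodule.closed_of_finiteDimensional _
    intro e
    suffices e ∈ ((LinearMap.range (M : Z →ₗ[ℝ] Z) : Submodule ℝ Z) : Set Z) by
      simpa using this
    rw [← hcl.closure_eq, Metric.mem_closure_iff]
    intro ε hε
    have hη : 0 < ε / (‖e‖ + 1) := by positivity
    have hline : Tendsto (fun t : ℝ => z + t • e) (𝓝[>] 0) (𝓝 z) := by
      have : Continuous fun t : ℝ => z + t • e := by fun_prop
      simpa using (this.tendsto 0).mono_left nhdsWithin_le_nhds
    obtain ⟨t, ht, ht0⟩ := ((hline.eventually (hexp _ hη)).and self_mem_nhdsWithin).exists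
    replace ht0 : 0 < t := ht0
    refine ⟨t⁻¹ • M ((z + t • e + s (z + t • e)) - (z + s z)), ?_, ?_⟩
    · exact ⟨t⁻¹ • ((z + t • e + s (z + t • e)) - (z + s z)), by simp⟩
    · rw [add_sub_cancel_left] at ht
      rw [dist_eq_norm]
      have h2 : e - t⁻¹ • M ((z + t • e + s (z + t • e)) - (z + s z)) =
          t⁻¹ • (t • e - M ((z + t • e + s (z + t • e)) - (z + s z))) := by
        rw [smul_sub, smul_smul, inv_mul_cancel₀ ht0.ne', one_smul]
      rw [h2, norm_smul, Real.norm_eq_abs, abs_of_pos (inv_pos.2 ht0)]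
      rw [norm_smul, Real.norm_eq_abs, abs_of_pos ht0] at ht
      calc _ ≤ t⁻¹ * (ε / (‖e‖ + 1) * (t * ‖e‖)) := by gcongr
        _ = ε * (‖e‖ / (‖e‖ + 1)) := by field_simp
        _ < ε * 1 := by
          gcongr
          rw [div_lt_one (by positivity)]; linarith
        _ = ε := mul_one _
  have hinj : Function.Injective M :=
    (LinearMap.injective_iff_surjective (f := (M : Z →ₗ[ℝ] Z))).2 hsurj
  let N : Z ≃L[ℝ] Z :=
    (LinearEquiv.ofBijective (M : Z →ₗ[ℝ] Z) ⟨hinj, hsurj⟩).toContinuousLinearEquiv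
  have hN : ∀ y, N y = M y := fun y => rfl
  refine ⟨(N.symm : Z →L[ℝ] Z) - ContinuousLinearMap.id ℝ Z, fun η hη => ?_⟩
  have hpos : 0 < ‖(N.symm : Z →L[ℝ] Z)‖ + 1 := by positivity
  filter_upwards [hexp (η / (‖(N.symm : Z →L[ℝ] Z)‖ + 1)) (by positivity)] with x hx
  have h3 : s x - s z - ((N.symm : Z →L[ℝ] Z) - ContinuousLinearMap.id ℝ Z) (x - z) =
      -((N.symm : Z →L[ℝ] Z) (x - z - M ((x + s x) - (z + s z)))) := by
    simp only [_root_.sub_apply, ContinuousLinearEquiv.coe_coe,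
      ContinuousLinearMap.id_apply]
    rw [map_sub N.symm (x - z) (M _), ← hN, N.symm_apply_apply]
    abel
  rw [h3, norm_neg]
  refine ((N.symm : Z →L[ℝ] Z).le_opNorm _).trans ?_
  calc _ ≤ ‖(N.symm : Z →L[ℝ] Z)‖ * (η / (‖(N.symm : Z →L[ℝ] Z)‖ + 1) * ‖x - z‖) := by gcongr
    _ ≤ (‖(N.symm : Z →L[ℝ] Z)‖ + 1) * (η / (‖(N.symm : Z →L[ℝ] Z)‖ + 1) * ‖x - z‖) := by
        gcongr; linarith
    _ = η * ‖x - z‖ := by field_simp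

theorem second_order_expansion_of_subgradient_approx
    (hs : ∀ x y, F x + inner ℝ (s x) (y - x) ≤ F y) {z : Z} {A : Z →L[ℝ] Z}
    (hA : ∀ η > 0, ∀ᶠ x in 𝓝 z, ‖s x - s z - A (x - z)‖ ≤ η * ‖x - z‖) :
    ∀ η > 0, ∀ᶠ h in 𝓝 (0 : Z),
      |F (z + h) - F z - inner ℝ (s z) h - 1 / 2 * inner ℝ (A h) h| ≤ η * ‖h‖ ^ 2 := by
  intro η hη
  obtain ⟨r, hr, hball⟩ := Metric.eventually_nhds_iff_ball.1 (hA η hη)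
  filter_upwards [Metric.ball_mem_nhds (0 : Z) hr] with h hh
  rw [mem_ball_zero_iff] at hh
  have hin : ∀ t : ℝ, 0 ≤ t → t ≤ 1 →
      |inner ℝ (s (z + t • h)) h - inner ℝ (s z) h - t * inner ℝ (A h) h| ≤ η * ‖h‖ ^ 2 := by
    intro t ht0 ht1
    have hn : ‖t • h‖ ≤ ‖h‖ := by
      rw [norm_smul, Real.norm_eq_abs, abs_of_nonneg ht0]
      exact mul_le_of_le_one_left (norm_nonneg _) ht1
    have h1 := hball (z + t • h) (by
      rw [mem_ball_iff_norm, add_sub_cancel_left]; exact hn.trans_lt hh)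
    rw [add_sub_cancel_left, map_smul] at h1
    have h2 : inner ℝ (s (z + t • h)) h - inner ℝ (s z) h - t * inner ℝ (A h) h =
        inner ℝ (s (z + t • h) - s z - t • A h) h := by
      rw [inner_sub_left, inner_sub_left, real_inner_smul_left]
    rw [h2]
    refine (abs_real_inner_le_norm _ _).trans ?_
    calc _ ≤ (η * ‖t • h‖) * ‖h‖ := by gcongr
      _ ≤ (η * ‖h‖) * ‖h‖ := by gcongr
      _ = _ := by ring
  have hstep : ∀ a b : ℝ, F (z + b • h) - F (z + a • h) ≤ (b - a) * inner ℝ (s (z + b • h)) h := by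
    intro a b
    have := hs (z + b • h) (z + a • h)
    rw [show z + a • h - (z + b • h) = (a - b) • h by rw [sub_smul]; abel,
      inner_smul_right] at this
    linarith
  set Q := inner ℝ (A h) h with hQ
  set g : ℝ → ℝ := fun t => F (z + t • h) - t * inner ℝ (s z) h - 1 / 2 * t ^ 2 * Q with hg
  have h1 := le_of_quadratic_increments g (1 / 2 * Q) (η * ‖h‖ ^ 2) (by
    intro a b ha hab hb
    have h1 := hstep a b
    have h2 := (abs_le.1 (hin b (ha.trans hab) hb)).2
    have h3 : (b - a) * inner ℝ (s (z + b • h)) h ≤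
        (b - a) * (inner ℝ (s z) h + b * Q + η * ‖h‖ ^ 2) := by
      apply mul_le_mul_of_nonneg_left _ (by linarith)
      linarith
    simp only [hg]
    nlinarith)
  have h2 := le_of_quadratic_increments (fun t => - g t) (1 / 2 * Q) (η * ‖h‖ ^ 2) (by
    intro a b ha hab hb
    have h1 := hstep b a
    have h2 := (abs_le.1 (hin a ha (hab.trans hb))).1
    have h3 : (b - a) * (inner ℝ (s z) h + a * Q - η * ‖h‖ ^ 2) ≤
        (b - a) * inner ℝ (s (z + a • h)) h := by
      apply mul_le_mul_of_nonneg_left _ (by linarith)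
      linarith
    simp only [hg]
    nlinarith)
  simp only [hg, one_smul, zero_smul, add_zero] at h1 h2
  rw [abs_le]
  constructor <;> linarith

end Subgradient

section Perturbed

variable {Z : Type*} [NormedAddCommGroup Z] [InnerProductSpace ℝ Z] [FiniteDimensional ℝ Z]

/-- Almost every linear perturbation of `F - H`, with `F` a convex function (given through a
selection `s` of bounded subgradients) and `H` a coercive quadratic function, is maximized at
points where `F` has a second-order expansion. -/
theorem exists_perturbed_max_with_second_order_expansion
    {F : Z → ℝ} {s : Z → Z} {L : ℝ}
    (hs : ∀ x y, F x + inner ℝ (s x) (y - x) ≤ F y) (hL : ∀ x, ‖s x‖ ≤ L)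
    {H q : Z → ℝ} {DH : Z → Z} {C c C' : ℝ} (hC : 0 ≤ C) (hc : 0 < c)
    (hH : ∀ x h, H (x + h) = H x + inner ℝ (DH x) h + q h)
    (hq : ∀ h, |q h| ≤ C * ‖h‖ ^ 2)
    (hDH : ∀ x y, ‖DH x - DH y‖ ≤ C * ‖x - y‖)
    (hco : ∀ x, c * ‖x‖ ^ 2 - C' ≤ H x) {δ : ℝ} (hδ : 0 < δ) :
    ∃ (p z : Z) (A : Z →L[ℝ] Z), ‖p‖ < δ ∧
      (∀ y, F y - H y - inner ℝ p y ≤ F z - H z - inner ℝ p z) ∧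
      ∀ η > 0, ∀ᶠ h in 𝓝 (0 : Z),
        |F (z + h) - F z - inner ℝ (DH z + p) h - 1 / 2 * inner ℝ (A h) h| ≤ η * ‖h‖ ^ 2 := by
  classical
  have hL0 : 0 ≤ L := (norm_nonneg _).trans (hL 0)
  have hexpand : ∀ x y, ‖x - y‖ ≤ ‖(x + s x) - (y + s y)‖ := by
    intro x y
    have h1 := hs x y
    have h2 := hs y x
    have h3 : 0 ≤ inner ℝ (s x - s y) (x - y) := by
      rw [inner_sub_left]
      rw [← neg_sub x y, inner_neg_right] at h1
      linarith
    have h4 : ‖x - y‖ ^ 2 ≤ ‖(x + s x) - (y + s y)‖ ^ 2 := by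
      rw [show (x + s x) - (y + s y) = (x - y) + (s x - s y) by abel, norm_add_sq_real,
        real_inner_comm]
      nlinarith [sq_nonneg ‖s x - s y‖]
    exact (pow_le_pow_iff_left₀ (norm_nonneg _) (norm_nonneg _) two_ne_zero).1 h4
  have hinj : Function.Injective fun x => x + s x := by
    intro x y hxy
    have := hexpand x y
    simp only at hxy
    rw [hxy, sub_self, norm_zero] at this
    exact sub_eq_zero.1 (norm_le_zero_iff.1 this)
  obtain ⟨J, hJlip, hJeq⟩ :=
    (LipschitzOnWith.of_dist_le_mul (K := 1) (s := range fun x => x + s x)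
      (f := Function.invFun fun x => x + s x) (by
        rintro _ ⟨x, rfl⟩ _ ⟨y, rfl⟩
        rw [Function.leftInverse_invFun hinj x, Function.leftInverse_invFun hinj y,
          dist_eq_norm, dist_eq_norm]
        simpa using hexpand x y)).extend_finite_dimension
  have hJ : ∀ x, J (x + s x) = x := fun x =>
    (hJeq ⟨x, rfl⟩).symm.trans (Function.leftInverse_invFun hinj x)
  have hDHlip : LipschitzWith C.toNNReal DH :=
    LipschitzWith.of_dist_le_mul fun x y => by
      rw [dist_eq_norm, dist_eq_norm, Real.coe_toNNReal _ hC]; exact hDH x y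
  obtain ⟨KΘ, hΘ⟩ : ∃ K, LipschitzWith K fun w => w - J w - DH (J w) :=
    ⟨_, (LipschitzWith.id.sub hJlip).sub (hDHlip.comp hJlip)⟩
  obtain ⟨p, hpδ, hp⟩ : ∃ p : Z, ‖p‖ < δ ∧
      ∀ w, w - J w - DH (J w) = p → DifferentiableAt ℝ J w := by
    let _ : MeasurableSpace Z := borel Z
    have : BorelSpace Z := ⟨rfl⟩
    set μ : MeasureTheory.Measure Z :=
      MeasureTheory.Measure.hausdorffMeasure (Module.finrank ℝ Z : ℝ) with hμ
    have hae : ∀ᵐ w ∂μ, DifferentiableAt ℝ J w := hJlip.ae_differentiableAt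
    have hnull : μ ((fun w => w - J w - DH (J w)) '' {w | ¬ DifferentiableAt ℝ J w}) = 0 := by
      have h1 := hΘ.hausdorffMeasure_image_le (d := (Module.finrank ℝ Z : ℝ)) (by positivity)
        {w | ¬ DifferentiableAt ℝ J w}
      rw [MeasureTheory.ae_iff] at hae
      rw [← hμ, hae, mul_zero] at h1
      exact nonpos_iff_eq_zero.1 h1
    have hball : 0 < μ (Metric.ball (0 : Z) δ) := Metric.measure_ball_pos μ 0 hδ
    by_contra! hcon
    refine hball.ne' (MeasureTheory.measure_mono_null ?_ hnull)
    intro p hp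
    obtain ⟨w, hw, hd⟩ := hcon p (mem_ball_zero_iff.1 hp)
    exact ⟨w, hd, hw⟩
  have hFlip : ∀ x y, F x - F y ≤ L * ‖x - y‖ := by
    intro x y
    have h1 := hs x y
    have h2 : -(L * ‖x - y‖) ≤ inner ℝ (s x) (y - x) := by
      have h3 := (abs_le.1 (abs_real_inner_le_norm (s x) (y - x))).1
      have h4 : ‖s x‖ * ‖y - x‖ ≤ L * ‖x - y‖ := by
        rw [norm_sub_rev y x]; gcongr; exact hL x
      linarith
    linarith
  have hFc : Continuous F := by
    refine (LipschitzWith.of_dist_le_mul (K := L.toNNReal) fun x y => ?_).continuous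
    rw [Real.dist_eq, Real.coe_toNNReal _ hL0, dist_eq_norm, abs_le]
    have h1 := hFlip y x
    rw [norm_sub_rev] at h1
    constructor <;> linarith [hFlip x y]
  have hHc : Continuous H := by
    rw [continuous_iff_continuousAt]
    intro x
    have h1 : Tendsto (fun y => inner ℝ (DH x) (y - x) + q (y - x)) (𝓝 x) (𝓝 0) := by
      have h2 : Tendsto (fun y => inner ℝ (DH x) (y - x)) (𝓝 x) (𝓝 0) := by
        have : Continuous fun y => inner ℝ (DH x) (y - x) := by fun_prop
        simpa using this.tendsto x
      have h3 : Tendsto (fun y => q (y - x)) (𝓝 x) (𝓝 0) := by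
        refine squeeze_zero_norm (fun y => (hq (y - x))) ?_
        have : Continuous fun y => C * ‖y - x‖ ^ 2 := by fun_prop
        simpa using this.tendsto x
      simpa using h2.add h3
    have h4 := h1.const_add (H x)
    rw [add_zero] at h4
    refine h4.congr fun y => ?_
    have := hH x (y - x)
    rw [add_sub_cancel] at this
    linarith
  obtain ⟨z, hz⟩ : ∃ z, ∀ y, F y - H y - inner ℝ p y ≤ F z - H z - inner ℝ p z := by
    refine Continuous.exists_forall_ge' (f := fun y => F y - H y - inner ℝ p y)
      (by fun_prop) 0 ?_
    have h1 : Tendsto (fun y : Z => c * ‖y‖ ^ 2 - (L + ‖p‖) * ‖y‖) (cocompact Z) atTop := by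
      have h2 : Tendsto (fun r : ℝ => r * (c * r - (L + ‖p‖))) atTop atTop :=
        tendsto_id.atTop_mul_atTop₀
          (tendsto_atTop_add_const_right _ _ (tendsto_id.const_mul_atTop hc))
      refine (h2.comp (tendsto_norm_cocompact_atTop (E := Z))).congr fun y => ?_
      simp only [Function.comp]
      ring
    filter_upwards [h1.eventually_ge_atTop (C' + H 0)] with y hy
    have h3 := hFlip y 0
    have h4 := hco y
    have h5 := (abs_le.1 (abs_real_inner_le_norm p y)).1
    rw [sub_zero] at h3
    rw [inner_zero_right]
    nlinarith
  have htouch : ∀ h, F (z + h) ≤ F z + inner ℝ (DH z + p) h + C * ‖h‖ ^ 2 := by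
    intro h
    have h1 := hz (z + h)
    have h2 := (abs_le.1 (hq h)).2
    rw [hH, inner_add_right] at h1
    rw [inner_add_left]
    linarith
  have hsz : s z = DH z + p := subgradient_eq_of_le_quadratic hs hC htouch
  have hd : DifferentiableAt ℝ J (z + s z) := by
    apply hp
    rw [hJ, hsz]
    abel
  obtain ⟨A, hA⟩ := exists_linear_approx_of_resolvent_differentiable (K := 4 * C) (by positivity)
    (subgradient_lipschitz_at_of_le_quadratic hs hC (by rw [hsz]; exact htouch)) hJ hd
  refine ⟨p, z, A, hpδ, hz, ?_⟩
  rw [← hsz]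
  exact second_order_expansion_of_subgradient_approx hs hA

end Perturbed

section Doubling

variable {E : Type*} [NormedAddCommGroup E] [InnerProductSpace ℝ E]

/-- The sup-convolution of an upper semicontinuous function on a compact set, up to the
quadratic term `lam / 2 * ‖X‖ ^ 2`, together with a selection of maximizers. -/
theorem exists_supConvolution {K : Set E} (hKne : K.Nonempty) (hK : IsCompact K) {u : E → ℝ}
    (hu : UpperSemicontinuousOn u K) (lam : ℝ) :
    ∃ (F : E → ℝ) (m : E → E), (∀ X, m X ∈ K) ∧
      (∀ X, F X = u (m X) + (lam * inner ℝ X (m X) - lam / 2 * ‖m X‖ ^ 2)) ∧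
      ∀ X, ∀ P ∈ K, u P + (lam * inner ℝ X P - lam / 2 * ‖P‖ ^ 2) ≤ F X := by
  have h : ∀ X : E, ∃ m ∈ K, ∀ P ∈ K, u P + (lam * inner ℝ X P - lam / 2 * ‖P‖ ^ 2) ≤
      u m + (lam * inner ℝ X m - lam / 2 * ‖m‖ ^ 2) := by
    intro X
    have hc : ContinuousOn (fun P : E => lam * inner ℝ X P - lam / 2 * ‖P‖ ^ 2) K := by fun_prop
    obtain ⟨m, hm, hmax⟩ := (hu.add hc.upperSemicontinuousOn).exists_isMaxOn hKne hK
    exact ⟨m, hm, fun P hP => hmax hP⟩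
  choose m hm hmax using h
  exact ⟨_, m, hm, fun X => rfl, hmax⟩

theorem touching_of_supConvolution_expansion {K : Set E} {u F : E → ℝ} {lam : ℝ} {X P G : E}
    {A : E →L[ℝ] E}
    (hF : F X = u P + (lam * inner ℝ X P - lam / 2 * ‖P‖ ^ 2))
    (hle : ∀ X, ∀ P ∈ K, u P + (lam * inner ℝ X P - lam / 2 * ‖P‖ ^ 2) ≤ F X)
    (hA : ∀ η > 0, ∀ᶠ h in 𝓝 (0 : E),
      |F (X + h) - F X - inner ℝ (G + lam • X) h - 1 / 2 * inner ℝ (A h) h| ≤ η * ‖h‖ ^ 2) :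
    ∀ η > 0, ∀ᶠ P' in 𝓝[K] P, u P' ≤ u P + inner ℝ G (P' - P) +
      1 / 2 * inner ℝ ((A - lam • ContinuousLinearMap.id ℝ E) (P' - P)) (P' - P) +
      η * ‖P' - P‖ ^ 2 := by
  intro η hη
  have ht : Tendsto (fun P' => P' - P) (𝓝[K] P) (𝓝 0) := by
    have : Continuous fun P' => P' - P := by fun_prop
    simpa using (this.tendsto P).mono_left nhdsWithin_le_nhds
  filter_upwards [ht.eventually (hA η hη), self_mem_nhdsWithin] with P' h1 hP'
  have h2 := hle (X + (P' - P)) P' hP'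
  obtain ⟨h, rfl⟩ : ∃ h, P' = P + h := ⟨P' - P, by abel⟩
  rw [add_sub_cancel_left] at *
  have h3 := (abs_le.1 h1).2
  rw [hF] at h3
  simp only [_root_.sub_apply, _root_.smul_apply, ContinuousLinearMap.id_apply,
    inner_sub_left, inner_add_left, inner_add_right, real_inner_smul_left,
    norm_add_sq_real, real_inner_self_eq_norm_sq] at h2 h3 ⊢
  rw [real_inner_comm P h] at h2
  linarith

theorem quadratic_le_of_max_of_expansion {F₁ F₂ : E → ℝ} {X Y G₁ G₂ : E} {A B : E →L[ℝ] E}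
    {q : E → E → ℝ}
    (hq : ∀ (t : ℝ) h k, q (t • h) (t • k) = t ^ 2 * q h k)
    (hmax : ∀ h k, F₁ (X + h) + F₂ (Y + k) ≤
      F₁ X + F₂ Y + inner ℝ G₁ h + inner ℝ G₂ k + q h k)
    (hA : ∀ η > 0, ∀ᶠ h in 𝓝 (0 : E),
      |F₁ (X + h) - F₁ X - inner ℝ G₁ h - 1 / 2 * inner ℝ (A h) h| ≤ η * ‖h‖ ^ 2)
    (hB : ∀ η > 0, ∀ᶠ h in 𝓝 (0 : E),
      |F₂ (Y + h) - F₂ Y - inner ℝ G₂ h - 1 / 2 * inner ℝ (B h) h| ≤ η * ‖h‖ ^ 2)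
    (h k : E) : 1 / 2 * inner ℝ (A h) h + 1 / 2 * inner ℝ (B k) k ≤ q h k := by
  have hline : ∀ e : E, Tendsto (fun t : ℝ => t • e) (𝓝[>] 0) (𝓝 0) := by
    intro e
    have : Continuous fun t : ℝ => t • e := by fun_prop
    simpa using (this.tendsto 0).mono_left nhdsWithin_le_nhds
  have hη : ∀ η > 0, 1 / 2 * inner ℝ (A h) h + 1 / 2 * inner ℝ (B k) k ≤
      q h k + η * (‖h‖ ^ 2 + ‖k‖ ^ 2) := by
    intro η hη
    obtain ⟨t, ⟨h1, h2⟩, ht⟩ := ((((hline h).eventually (hA η hη)).and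
      ((hline k).eventually (hB η hη))).and self_mem_nhdsWithin).exists
    replace ht : 0 < t := ht
    have h3 := hmax (t • h) (t • k)
    have h4 := (abs_le.1 h1).1
    have h5 := (abs_le.1 h2).1
    rw [hq] at h3
    simp only [map_smul, inner_smul_left, inner_smul_right, norm_smul, Real.norm_eq_abs,
      mul_pow, sq_abs, RCLike.conj_to_real] at h3 h4 h5
    have h6 : t ^ 2 * (1 / 2 * inner ℝ (A h) h + 1 / 2 * inner ℝ (B k) k) ≤
      t ^ 2 * (q h k + η * (‖h‖ ^ 2 + ‖k‖ ^ 2)) := by nlinarith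
    exact le_of_mul_le_mul_left h6 (by positivity)
  refine le_of_forall_pos_le_add fun ε hε => ?_
  refine (hη (ε / (‖h‖ ^ 2 + ‖k‖ ^ 2 + 1)) (by positivity)).trans ?_
  gcongr
  rw [div_mul_eq_mul_div, div_le_iff₀ (by positivity)]
  nlinarith

variable [FiniteDimensional ℝ E]

/-- A form of the theorem on sums of Crandall, Ishii and Lions, for quadratic penalizations. -/
theorem exists_doubled_contact {K : Set E} (hKne : K.Nonempty) (hK : IsCompact K) {u w : E → ℝ}
    (hu : UpperSemicontinuousOn u K) (hw : UpperSemicontinuousOn w K) {lam C : ℝ}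
    (hlam : 0 < lam) (hC : 0 ≤ C) {H : E → E → ℝ} {D₁ D₂ : E → E → E} {q : E → E → ℝ}
    (hH : ∀ X Y h k, H (X + h) (Y + k) =
      H X Y + inner ℝ (D₁ X Y) h + inner ℝ (D₂ X Y) k + q h k)
    (hq : ∀ h k, |q h k| ≤ C * (‖h‖ ^ 2 + ‖k‖ ^ 2))
    (hq' : ∀ (t : ℝ) h k, q (t • h) (t • k) = t ^ 2 * q h k)
    (hD₁ : ∀ X Y X' Y', ‖D₁ X Y - D₁ X' Y'‖ ≤ C * (‖X - X'‖ + ‖Y - Y'‖))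
    (hD₂ : ∀ X Y X' Y', ‖D₂ X Y - D₂ X' Y'‖ ≤ C * (‖X - X'‖ + ‖Y - Y'‖))
    (hH0 : ∀ X Y, 0 ≤ H X Y) {δ : ℝ} (hδ : 0 < δ) :
    ∃ (X Y P Q p r : E) (A B : E →L[ℝ] E), P ∈ K ∧ Q ∈ K ∧ ‖p‖ < δ ∧ ‖r‖ < δ ∧
      (∀ P' ∈ K, ∀ Q' ∈ K, ∀ X' Y', u P' + w Q' - lam / 2 * ‖X' - P'‖ ^ 2
          - lam / 2 * ‖Y' - Q'‖ ^ 2 - H X' Y' - inner ℝ p X' - inner ℝ r Y' ≤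
        u P + w Q - lam / 2 * ‖X - P‖ ^ 2
          - lam / 2 * ‖Y - Q‖ ^ 2 - H X Y - inner ℝ p X - inner ℝ r Y) ∧
      (∀ η > 0, ∀ᶠ P' in 𝓝[K] P, u P' ≤ u P + inner ℝ (D₁ X Y + p) (P' - P) +
        1 / 2 * inner ℝ (A (P' - P)) (P' - P) + η * ‖P' - P‖ ^ 2) ∧
      (∀ η > 0, ∀ᶠ Q' in 𝓝[K] Q, w Q' ≤ w Q + inner ℝ (D₂ X Y + r) (Q' - Q) +
        1 / 2 * inner ℝ (B (Q' - Q)) (Q' - Q) + η * ‖Q' - Q‖ ^ 2) ∧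
      ∀ h k, 1 / 2 * inner ℝ (A h) h + 1 / 2 * inner ℝ (B k) k ≤ q h k := by
  obtain ⟨F₁, m₁, hm₁, hF₁, hle₁⟩ := exists_supConvolution hKne hK hu lam
  obtain ⟨F₂, m₂, hm₂, hF₂, hle₂⟩ := exists_supConvolution hKne hK hw lam
  obtain ⟨R, hR⟩ := hK.isBounded.exists_norm_le
  have hR0 : 0 ≤ R := (norm_nonneg _).trans (hR _ (hm₁ 0))
  have hnorm : ∀ z : WithLp 2 (E × E), ‖z‖ ^ 2 = ‖z.fst‖ ^ 2 + ‖z.snd‖ ^ 2 :=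
    WithLp.prod_norm_sq_eq_of_L2
  have hinner : ∀ z y : WithLp 2 (E × E),
      inner ℝ z y = inner ℝ z.fst y.fst + inner ℝ z.snd y.snd := WithLp.prod_inner_apply
  let e := WithLp.prodContinuousLinearEquiv 2 ℝ E E
  obtain ⟨J, hfst', hsnd', hJ⟩ : ∃ J : E → E → WithLp 2 (E × E), (∀ a b, (J a b).fst = a) ∧
      (∀ a b, (J a b).snd = b) ∧ ∀ a b, e.symm (a, b) = J a b :=
    ⟨fun a b => WithLp.toLp 2 (a, b), fun _ _ => rfl, fun _ _ => rfl, fun _ _ => rfl⟩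
  have hfst : ∀ z : WithLp 2 (E × E), ‖z.fst‖ ≤ ‖z‖ := fun z => by
    rw [← pow_le_pow_iff_left₀ (norm_nonneg _) (norm_nonneg _) two_ne_zero, hnorm]
    linarith [sq_nonneg ‖z.snd‖]
  have hsnd : ∀ z : WithLp 2 (E × E), ‖z.snd‖ ≤ ‖z‖ := fun z => by
    rw [← pow_le_pow_iff_left₀ (norm_nonneg _) (norm_nonneg _) two_ne_zero, hnorm]
    linarith [sq_nonneg ‖z.fst‖]
  have hsum : ∀ z : WithLp 2 (E × E), ‖z‖ ≤ ‖z.fst‖ + ‖z.snd‖ := fun z => by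
    rw [← pow_le_pow_iff_left₀ (norm_nonneg _) (by positivity) two_ne_zero, hnorm]
    nlinarith [norm_nonneg z.fst, norm_nonneg z.snd]
  have hsub : ∀ (F : E → ℝ) (u : E → ℝ) (m : E → E), (∀ X, m X ∈ K) →
      (∀ X, F X = u (m X) + (lam * inner ℝ X (m X) - lam / 2 * ‖m X‖ ^ 2)) →
      (∀ X, ∀ P ∈ K, u P + (lam * inner ℝ X P - lam / 2 * ‖P‖ ^ 2) ≤ F X) →
      ∀ X Y, F X + inner ℝ (lam • m X) (Y - X) ≤ F Y := by
    intro F u m hm hF hle X Y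
    have h1 := hle Y (m X) (hm X)
    rw [hF X, real_inner_smul_left, inner_sub_right, real_inner_comm Y, real_inner_comm X]
    linarith
  obtain ⟨p, z, A, hp, hz, hA⟩ := exists_perturbed_max_with_second_order_expansion
    (Z := WithLp 2 (E × E)) (F := fun z => F₁ z.fst + F₂ z.snd)
    (s := fun z => J (lam • m₁ z.fst) (lam • m₂ z.snd)) (L := 2 * (lam * R))
    (H := fun z => H z.fst z.snd + lam / 2 * ‖z‖ ^ 2)
    (DH := fun z => J (D₁ z.fst z.snd + lam • z.fst) (D₂ z.fst z.snd + lam • z.snd))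
    (q := fun z => q z.fst z.snd + lam / 2 * ‖z‖ ^ 2) (C := 4 * C + 2 * lam) (c := lam / 2)
    (C' := 0)
    (fun x y => by
      have h1 := hsub F₁ u m₁ hm₁ hF₁ hle₁ x.fst y.fst
      have h2 := hsub F₂ w m₂ hm₂ hF₂ hle₂ x.snd y.snd
      rw [hinner, hfst', hsnd', WithLp.sub_fst, WithLp.sub_snd]
      linarith)
    (fun x => by
      refine (hsum _).trans ?_
      rw [hfst', hsnd', norm_smul, norm_smul, Real.norm_eq_abs, abs_of_pos hlam]
      have h1 := mul_le_mul_of_nonneg_left (hR _ (hm₁ x.fst)) hlam.le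
      have h2 := mul_le_mul_of_nonneg_left (hR _ (hm₂ x.snd)) hlam.le
      linarith)
    (by positivity) (by positivity)
    (fun x h => by
      simp only [hfst', hsnd', WithLp.add_fst, WithLp.add_snd, hinner, hnorm, hH, inner_add_left,
        real_inner_smul_left, norm_add_sq_real]
      ring)
    (fun h => by
      have h1 := hq h.fst h.snd
      rw [← hnorm] at h1
      have h2 : |lam / 2 * ‖h‖ ^ 2| = lam / 2 * ‖h‖ ^ 2 := abs_of_nonneg (by positivity)
      refine (abs_add_le _ _).trans ?_
      rw [h2]
      nlinarith [sq_nonneg ‖h‖, mul_nonneg hC (sq_nonneg ‖h‖), mul_nonneg hlam.le (sq_nonneg ‖h‖)])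
    (fun x y => by
      refine (hsum _).trans ?_
      have h1 := hD₁ x.fst x.snd y.fst y.snd
      have h2 := hD₂ x.fst x.snd y.fst y.snd
      have h3 := hfst (x - y)
      have h4 := hsnd (x - y)
      rw [WithLp.sub_fst] at h3
      rw [WithLp.sub_snd] at h4
      rw [WithLp.sub_fst, WithLp.sub_snd, hfst', hsnd', hfst', hsnd']
      have h5 : ‖D₁ x.fst x.snd + lam • x.fst - (D₁ y.fst y.snd + lam • y.fst)‖ ≤
          C * (‖x.fst - y.fst‖ + ‖x.snd - y.snd‖) + lam * ‖x.fst - y.fst‖ := by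
        rw [add_sub_add_comm, ← smul_sub]
        refine (norm_add_le _ _).trans ?_
        rw [norm_smul, Real.norm_eq_abs, abs_of_pos hlam]
        linarith
      have h6 : ‖D₂ x.fst x.snd + lam • x.snd - (D₂ y.fst y.snd + lam • y.snd)‖ ≤
          C * (‖x.fst - y.fst‖ + ‖x.snd - y.snd‖) + lam * ‖x.snd - y.snd‖ := by
        rw [add_sub_add_comm, ← smul_sub]
        refine (norm_add_le _ _).trans ?_
        rw [norm_smul, Real.norm_eq_abs, abs_of_pos hlam]
        linarith
      nlinarith [mul_le_mul_of_nonneg_left h3 hC, mul_le_mul_of_nonneg_left h4 hC,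
        mul_le_mul_of_nonneg_left h3 hlam.le, mul_le_mul_of_nonneg_left h4 hlam.le])
    (fun x => by
      have := hH0 x.fst x.snd
      linarith)
    hδ
  let A₁ : E →L[ℝ] E := (ContinuousLinearMap.fst ℝ E E) ∘L (e : WithLp 2 (E × E) →L[ℝ] E × E) ∘L A
    ∘L (e.symm : E × E →L[ℝ] WithLp 2 (E × E)) ∘L (ContinuousLinearMap.inl ℝ E E)
  let A₂ : E →L[ℝ] E := (ContinuousLinearMap.snd ℝ E E) ∘L (e : WithLp 2 (E × E) →L[ℝ] E × E) ∘L A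
    ∘L (e.symm : E × E →L[ℝ] WithLp 2 (E × E)) ∘L (ContinuousLinearMap.inr ℝ E E)
  have hA₁ : ∀ h, A₁ h = (A (J h 0)).fst := fun h => by
    rw [← hJ]; rfl
  have hA₂ : ∀ h, A₂ h = (A (J 0 h)).snd := fun h => by
    rw [← hJ]; rfl
  have hexp₁ : ∀ η > 0, ∀ᶠ h in 𝓝 (0 : E), |F₁ (z.fst + h) - F₁ z.fst
      - inner ℝ ((D₁ z.fst z.snd + p.fst) + lam • z.fst) h - 1 / 2 * inner ℝ (A₁ h) h| ≤
      η * ‖h‖ ^ 2 := by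
    intro η hη
    have ht : Tendsto (fun h : E => J h 0)
        (𝓝 0) (𝓝 0) := by
      have : Continuous fun h : E => e.symm (h, (0 : E)) := by fun_prop
      have h1 := this.tendsto 0
      rw [Prod.mk_zero_zero, map_zero] at h1
      simpa only [hJ] using h1
    filter_upwards [ht.eventually (hA η hη)] with h hh
    simp only [hfst', hsnd', WithLp.add_fst, WithLp.add_snd, hinner, hnorm, add_zero,
      inner_zero_right,
      norm_zero] at hh
    rw [hA₁]
    convert hh using 2
    · simp only [inner_add_left]; ring
    · ring
  have hexp₂ : ∀ η > 0, ∀ᶠ h in 𝓝 (0 : E), |F₂ (z.snd + h) - F₂ z.snd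
      - inner ℝ ((D₂ z.fst z.snd + p.snd) + lam • z.snd) h - 1 / 2 * inner ℝ (A₂ h) h| ≤
      η * ‖h‖ ^ 2 := by
    intro η hη
    have ht : Tendsto (fun h : E => J 0 h)
        (𝓝 0) (𝓝 0) := by
      have : Continuous fun h : E => e.symm ((0 : E), h) := by fun_prop
      have h1 := this.tendsto 0
      rw [Prod.mk_zero_zero, map_zero] at h1
      simpa only [hJ] using h1
    filter_upwards [ht.eventually (hA η hη)] with h hh
    simp only [hfst', hsnd', WithLp.add_fst, WithLp.add_snd, hinner, hnorm, add_zero,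
      inner_zero_right,
      norm_zero] at hh
    rw [hA₂]
    convert hh using 2
    · simp only [inner_add_left]; ring
    · ring
  have hmax : ∀ X' Y', F₁ X' + F₂ Y' - (H X' Y' + lam / 2 * (‖X'‖ ^ 2 + ‖Y'‖ ^ 2))
      - (inner ℝ p.fst X' + inner ℝ p.snd Y') ≤
      F₁ z.fst + F₂ z.snd - (H z.fst z.snd + lam / 2 * (‖z.fst‖ ^ 2 + ‖z.snd‖ ^ 2))
      - (inner ℝ p.fst z.fst + inner ℝ p.snd z.snd) := by
    intro X' Y'
    have := hz (J X' Y')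
    simpa only [hfst', hsnd', hinner, hnorm] using this
  refine ⟨z.fst, z.snd, m₁ z.fst, m₂ z.snd, p.fst, p.snd,
    A₁ - lam • ContinuousLinearMap.id ℝ E, A₂ - lam • ContinuousLinearMap.id ℝ E,
    hm₁ _, hm₂ _, (hfst p).trans_lt hp, (hsnd p).trans_lt hp, ?_,
    touching_of_supConvolution_expansion (hF₁ _) hle₁ hexp₁,
    touching_of_supConvolution_expansion (hF₂ _) hle₂ hexp₂, ?_⟩
  · intro P' hP' Q' hQ' X' Y'
    have h1 := hmax X' Y'
    have h2 := hle₁ X' P' hP'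
    have h3 := hle₂ Y' Q' hQ'
    rw [hF₁ z.fst, hF₂ z.snd] at h1
    simp only [norm_sub_sq_real]
    linarith
  · intro h k
    have h1 := quadratic_le_of_max_of_expansion (F₁ := F₁) (F₂ := F₂)
      (q := fun h k => q h k + lam / 2 * (‖h‖ ^ 2 + ‖k‖ ^ 2))
      (fun t h k => by
        simp only [hq', norm_smul, Real.norm_eq_abs, mul_pow, sq_abs]; ring)
      (fun h k => by
        have h1 := hmax (z.fst + h) (z.snd + k)
        simp only [hH, norm_add_sq_real, inner_add_left, inner_add_right,
          real_inner_smul_left] at h1 ⊢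
        linarith) hexp₁ hexp₂ h k
    simp only [_root_.sub_apply, _root_.smul_apply, ContinuousLinearMap.id_apply,
      inner_sub_left, real_inner_smul_left, real_inner_self_eq_norm_sq]
    linarith

end Doubling

section TestFunctions

variable {n d : ℕ}

/-- The `k`-th column of a matrix as a vector of `ℝ^n`. -/
def colVec (M : Matrix (Fin n) (Fin d) ℝ) (k : Fin d) : En n := WithLp.toLp 2 fun i => M i k

/-- The vector `Mᵀp`. -/
def transMulVec (M : Matrix (Fin n) (Fin d) ℝ) (p : En n) : Ed d :=
  WithLp.toLp 2 fun k => ∑ i, M i k * p i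

theorem colVec_sub (M N : Matrix (Fin n) (Fin d) ℝ) (k : Fin d) :
    colVec (M - N) k = colVec M k - colVec N k := rfl

theorem frob_nonneg (M : Matrix (Fin n) (Fin d) ℝ) : 0 ≤ frob M := Real.sqrt_nonneg _

theorem frob_sq (M : Matrix (Fin n) (Fin d) ℝ) : frob M ^ 2 = ∑ k, ‖colVec M k‖ ^ 2 := by
  rw [frob, Real.sq_sqrt (by positivity), Finset.sum_comm]
  simp [colVec, EuclideanSpace.real_norm_sq_eq]

theorem continuous_frob : Continuous fun M : Matrix (Fin n) (Fin d) ℝ => frob M := by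
  unfold frob
  refine Real.continuous_sqrt.comp ?_
  refine continuous_finsetSum _ fun i _ => continuous_finsetSum _ fun j _ => ?_
  exact (continuous_id.matrix_elem i j).pow 2

theorem transMulVec_apply (M : Matrix (Fin n) (Fin d) ℝ) (p : En n) (k : Fin d) :
    transMulVec M p k = inner ℝ (colVec M k) p := by
  simp [transMulVec, colVec, PiLp.inner_apply, mul_comm]

theorem norm_transMulVec_le (M : Matrix (Fin n) (Fin d) ℝ) (p : En n) :
    ‖transMulVec M p‖ ≤ frob M * ‖p‖ := by
  rw [← pow_le_pow_iff_left₀ (norm_nonneg _) (mul_nonneg (frob_nonneg _) (norm_nonneg _))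
    two_ne_zero, mul_pow, frob_sq, EuclideanSpace.real_norm_sq_eq, Finset.sum_mul]
  refine Finset.sum_le_sum fun k _ => ?_
  rw [transMulVec_apply, ← mul_pow, ← sq_abs]
  exact pow_le_pow_left₀ (abs_nonneg _) (abs_real_inner_le_norm _ _) 2

theorem transMulVec_sub (M N : Matrix (Fin n) (Fin d) ℝ) (p : En n) :
    transMulVec (M - N) p = transMulVec M p - transMulVec N p := by
  ext k
  simp [transMulVec_apply, colVec_sub, inner_sub_left]

theorem transMulVec_add_right (M : Matrix (Fin n) (Fin d) ℝ) (p q : En n) :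
    transMulVec M (p + q) = transMulVec M p + transMulVec M q := by
  ext k
  simp [transMulVec_apply, inner_add_right]

theorem transMulVec_neg_right (M : Matrix (Fin n) (Fin d) ℝ) (p : En n) :
    transMulVec M (-p) = -transMulVec M p := by
  ext k
  simp [transMulVec_apply, inner_neg_right]

theorem sigGrad_eq (σm : ℝ → En n → Matrix (Fin n) (Fin d) ℝ) (φ : ℝ → En n → ℝ) (t : ℝ)
    (x : En n) {p : En n} (hp : ∀ i, pd (φ t) x i = p i) :
    sigGrad σm φ t x = transMulVec (σm t x) p := by
  ext k
  simp [sigGrad, transMulVec, hp]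

theorem sum_mul_transpose_mul (M : Matrix (Fin n) (Fin d) ℝ) (X : Fin n → Fin n → ℝ) :
    ∑ i, ∑ j, (M * Mᵀ) i j * X i j = ∑ k, ∑ i, ∑ j, M i k * M j k * X i j := by
  simp only [Matrix.mul_apply, Matrix.transpose_apply, Finset.sum_mul]
  rw [Finset.sum_congr rfl fun i _ => Finset.sum_comm, Finset.sum_comm]

/-- Space-time with the Euclidean norm. -/
abbrev Est (n : ℕ) : Type := WithLp 2 (ℝ × En n)

/-- The point of Euclidean space-time with given time and space components. -/
def stPoint (t : ℝ) (x : En n) : Est n := WithLp.toLp 2 (t, x)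

theorem stPoint_fst (t : ℝ) (x : En n) : (stPoint t x).fst = t := rfl

theorem stPoint_snd (t : ℝ) (x : En n) : (stPoint t x).snd = x := rfl

theorem stPoint_fst_snd (z : Est n) : stPoint z.fst z.snd = z := rfl

theorem contDiff_stPoint {k : WithTop ℕ∞} :
    ContDiff ℝ k fun p : ℝ × En n => stPoint p.1 p.2 :=
  (WithLp.prodContinuousLinearEquiv 2 ℝ ℝ (En n)).symm.contDiff

theorem inner_stPoint (t : ℝ) (x : En n) (z : Est n) :
    inner ℝ z (stPoint t x) = t * z.fst + inner ℝ z.snd x := by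
  rw [WithLp.prod_inner_apply]
  simp [stPoint_fst, stPoint_snd]

/-- The quadratic function `c + ⟪G, z - P⟫ + ⟪A(z - P), z - P⟫ / 2` at `z = (t, x)`. -/
def quadFn (c : ℝ) (G P : Est n) (A : Est n →L[ℝ] Est n) (t : ℝ) (x : En n) : ℝ :=
  c + inner ℝ G (stPoint t x - P) + 1 / 2 * inner ℝ (A (stPoint t x - P)) (stPoint t x - P)

theorem isTest_quadFn (c : ℝ) (G P : Est n) (A : Est n →L[ℝ] Est n) :
    IsTest (quadFn c G P A) := by
  have h : ContDiff ℝ 2 fun p : ℝ × En n => stPoint p.1 p.2 - P :=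
    contDiff_stPoint.sub contDiff_const
  exact (contDiff_const.add (contDiff_const.inner ℝ h)).add
    (contDiff_const.mul ((A.contDiff.comp h).inner ℝ h))

theorem quadFn_self (c : ℝ) (G P : Est n) (A : Est n →L[ℝ] Est n) :
    quadFn c G P A P.fst P.snd = c := by
  simp [quadFn, stPoint_fst_snd]

theorem ptd_quadFn (c : ℝ) (G P : Est n) (A : Est n →L[ℝ] Est n) :
    ptd (quadFn c G P A) P.fst P.snd = G.fst := by
  have h : ∀ s, quadFn c G P A s P.snd = c + (s - P.fst) * G.fst +
      1 / 2 * (inner ℝ (A (stPoint 1 0)) (stPoint 1 0) * (s - P.fst) ^ 2) := by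
    intro s
    have h1 : stPoint s P.snd - P = (s - P.fst) • stPoint (n := n) 1 0 := by
      rw [← stPoint_fst_snd (stPoint s P.snd - P),
        ← stPoint_fst_snd ((s - P.fst) • stPoint (n := n) 1 0)]
      simp [stPoint_fst, stPoint_snd]
    rw [quadFn, h1, map_smul, inner_smul_left, inner_smul_right, inner_smul_right, inner_stPoint]
    simp
    ring
  have h1 : HasDerivAt (fun s => c + (s - P.fst) * G.fst +
      1 / 2 * (inner ℝ (A (stPoint 1 0)) (stPoint 1 0) * (s - P.fst) ^ 2)) (G.fst) P.fst := by
    have h2 := (hasDerivAt_id P.fst).sub_const P.fst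
    refine (((h2.mul_const G.fst).const_add c).add
      (((h2.pow 2).const_mul (inner ℝ (A (stPoint 1 0)) (stPoint 1 0))).const_mul
        (1 / 2))).congr_deriv ?_
    simp
  rw [ptd, funext h]
  exact h1.deriv

/-- Embedding of space directions into space-time. -/
def spaceDir : En n →L[ℝ] Est n :=
  ((WithLp.prodContinuousLinearEquiv 2 ℝ ℝ (En n)).symm : ℝ × En n →L[ℝ] Est n) ∘L
    ContinuousLinearMap.inr ℝ ℝ (En n)

theorem spaceDir_fst (x : En n) : (spaceDir x).fst = 0 := rfl

theorem spaceDir_snd (x : En n) : (spaceDir x).snd = x := rfl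

theorem inner_spaceDir (z : Est n) (x : En n) : inner ℝ z (spaceDir x) = inner ℝ z.snd x := by
  rw [WithLp.prod_inner_apply]
  simp [spaceDir_fst, spaceDir_snd]

theorem norm_spaceDir (x : En n) : ‖spaceDir x‖ = ‖x‖ := by
  rw [← pow_left_inj₀ (norm_nonneg _) (norm_nonneg _) two_ne_zero,
    WithLp.prod_norm_sq_eq_of_L2]
  simp [spaceDir_fst, spaceDir_snd]

theorem hasFDerivAt_quadFn (c : ℝ) (G P : Est n) (A : Est n →L[ℝ] Est n) (y : En n) :
    HasFDerivAt (quadFn c G P A P.fst)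
      (innerSL ℝ G ∘L spaceDir + (1 / 2 : ℝ) • (innerSL ℝ (spaceDir (y - P.snd)) ∘L A ∘L spaceDir
        + innerSL ℝ (A (spaceDir (y - P.snd))) ∘L spaceDir)) y := by
  have h : ∀ x, quadFn c G P A P.fst x = c + inner ℝ G (spaceDir (x - P.snd)) +
      1 / 2 * inner ℝ (A (spaceDir (x - P.snd))) (spaceDir (x - P.snd)) := by
    intro x
    have h1 : stPoint P.fst x - P = spaceDir (x - P.snd) := by
      rw [← stPoint_fst_snd (stPoint P.fst x - P), ← stPoint_fst_snd (spaceDir (x - P.snd))]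
      simp [stPoint_fst, stPoint_snd, spaceDir_fst, spaceDir_snd]
    rw [quadFn, h1]
  have h0 : HasFDerivAt (fun x => spaceDir (x - P.snd)) (spaceDir (n := n)) y :=
    (spaceDir (n := n)).hasFDerivAt.comp y ((hasFDerivAt_id y).sub_const P.snd)
  have h1 : HasFDerivAt (fun x => A (spaceDir (x - P.snd))) (A ∘L spaceDir (n := n)) y :=
    A.hasFDerivAt.comp y h0
  rw [funext h]
  refine ((((hasFDerivAt_const G y).inner ℝ h0).const_add c).add
    ((h1.inner ℝ h0).const_mul (1 / 2))).congr_fderiv ?_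
  ext z
  simp [real_inner_comm, -WithLp.prod_inner_apply, -map_sub]
  ring

theorem pd_quadFn (c : ℝ) (G P : Est n) (A : Est n →L[ℝ] Est n) (i : Fin n) :
    pd (quadFn c G P A P.fst) P.snd i = G.snd i := by
  rw [pd, (hasFDerivAt_quadFn c G P A P.snd).fderiv]
  simp [inner_spaceDir, PiLp.inner_apply, -WithLp.prod_inner_apply]

theorem pd2_quadFn (c : ℝ) (G P : Est n) (A : Est n →L[ℝ] Est n) (i j : Fin n) :
    pd2 (quadFn c G P A P.fst) P.snd i j =
      1 / 2 * (inner ℝ (A (spaceDir (EuclideanSpace.single i 1)))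
        (spaceDir (EuclideanSpace.single j 1)) +
      inner ℝ (A (spaceDir (EuclideanSpace.single j 1)))
        (spaceDir (EuclideanSpace.single i 1))) := by
  set e : Fin n → Est n := fun i => spaceDir (EuclideanSpace.single i 1) with he
  have h : ∀ y, fderiv ℝ (quadFn c G P A P.fst) y (EuclideanSpace.single j 1) =
      inner ℝ G (e j) + 1 / 2 * (inner ℝ (spaceDir (y - P.snd)) (A (e j)) +
        inner ℝ (A (spaceDir (y - P.snd))) (e j)) := by
    intro y
    rw [(hasFDerivAt_quadFn c G P A y).fderiv]
    simp [he, -WithLp.prod_inner_apply, -map_sub]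
    ring
  have h0 : HasFDerivAt (fun x => spaceDir (x - P.snd)) (spaceDir (n := n)) P.snd :=
    (spaceDir (n := n)).hasFDerivAt.comp P.snd ((hasFDerivAt_id P.snd).sub_const P.snd)
  have h1 : HasFDerivAt (fun x => A (spaceDir (x - P.snd))) (A ∘L spaceDir (n := n)) P.snd :=
    A.hasFDerivAt.comp P.snd h0
  rw [pd2, funext h]
  have h2 := (((h0.inner ℝ (hasFDerivAt_const (A (e j)) P.snd)).add
    (h1.inner ℝ (hasFDerivAt_const (e j) P.snd))).const_mul (1 / 2)).const_add (inner ℝ G (e j))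
  refine (congrArg (fun L : En n →L[ℝ] ℝ => L (EuclideanSpace.single i 1)) h2.fderiv).trans ?_
  simp [he, real_inner_comm, -WithLp.prod_inner_apply]
  ring

theorem genL_quadFn (a : ℝ → En n → En n) (σm : ℝ → En n → Matrix (Fin n) (Fin d) ℝ)
    (c : ℝ) (G P : Est n) (A : Est n →L[ℝ] Est n) :
    genL a σm (quadFn c G P A) P.fst P.snd = inner ℝ (a P.fst P.snd) G.snd +
      1 / 2 * ∑ k, inner ℝ (A (spaceDir (colVec (σm P.fst P.snd) k)))
        (spaceDir (colVec (σm P.fst P.snd) k)) := by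
  have hcol : ∀ k, colVec (σm P.fst P.snd) k =
      ∑ i, σm P.fst P.snd i k • (EuclideanSpace.single i 1 : En n) := by
    intro k
    ext i
    simp [colVec, Finset.sum_apply, Pi.single_apply]
  rw [genL, sum_mul_transpose_mul]
  congr 1
  · simp [pd_quadFn, PiLp.inner_apply, mul_comm]
  · congr 1
    refine Finset.sum_congr rfl fun k _ => ?_
    rw [hcol]
    simp only [map_sum, map_smul, sum_inner, inner_sum, inner_smul_left, inner_smul_right,
      pd2_quadFn, mul_add, Finset.sum_add_distrib]
    rw [Finset.sum_comm]
    rw [← Finset.sum_add_distrib]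
    refine Finset.sum_congr rfl fun j _ => ?_
    rw [← Finset.sum_add_distrib, Finset.mul_sum]
    refine Finset.sum_congr rfl fun i _ => ?_
    simp only [conj_trivial]
    ring

theorem sigGrad_quadFn (σm : ℝ → En n → Matrix (Fin n) (Fin d) ℝ)
    (c : ℝ) (G P : Est n) (A : Est n →L[ℝ] Est n) :
    sigGrad σm (quadFn c G P A) P.fst P.snd = transMulVec (σm P.fst P.snd) G.snd :=
  sigGrad_eq _ _ _ _ fun i => pd_quadFn c G P A i

theorem pd_sub_smul {g h : En n → ℝ} {x : En n} (hg : DifferentiableAt ℝ g x)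
    (hh : DifferentiableAt ℝ h x) (θ : ℝ) (i : Fin n) :
    pd (fun y => g y - θ * h y) x i = pd g x i - θ * pd h x i := by
  rw [pd, fderiv_fun_sub hg (hh.const_mul θ), fderiv_const_mul hh]
  rfl

theorem pd2_sub_smul {g h : En n → ℝ} {x : En n} (hg : ContDiff ℝ 2 g)
    (hh : ContDiff ℝ 2 h) (θ : ℝ) (i j : Fin n) :
    pd2 (fun y => g y - θ * h y) x i j = pd2 g x i j - θ * pd2 h x i j := by
  have h1 : ∀ f : En n → ℝ, ContDiff ℝ 2 f →
      Differentiable ℝ fun y => fderiv ℝ f y (EuclideanSpace.single j 1) := fun f hf =>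
    ((hf.fderiv_right (m := 1) (by norm_num)).clm_apply contDiff_const).differentiable one_ne_zero
  have h2 := pd_sub_smul (h1 g hg x) (h1 h hh x) θ i
  rw [pd2, pd2, pd2]
  have h3 : (fun y => fderiv ℝ (fun z => g z - θ * h z) y (EuclideanSpace.single j 1)) =
      fun y => fderiv ℝ g y (EuclideanSpace.single j 1) -
        θ * fderiv ℝ h y (EuclideanSpace.single j 1) :=
    funext fun y => pd_sub_smul (hg.differentiable two_ne_zero y)
      (hh.differentiable two_ne_zero y) θ j
  rw [h3]
  exact h2

theorem IsTest.contDiff_space {φ : ℝ → En n → ℝ} (h : IsTest φ) (t : ℝ) : ContDiff ℝ 2 (φ t) :=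
  ContDiff.comp (g := fun p : ℝ × En n => φ p.1 p.2) h (contDiff_const.prodMk contDiff_id)

theorem IsTest.contDiff_time {φ : ℝ → En n → ℝ} (h : IsTest φ) (x : En n) :
    ContDiff ℝ 2 fun t => φ t x :=
  ContDiff.comp (g := fun p : ℝ × En n => φ p.1 p.2) h (contDiff_id.prodMk contDiff_const)

theorem IsTest.sub_smul {φ χ : ℝ → En n → ℝ} (hφ : IsTest φ) (hχ : IsTest χ) (θ : ℝ) :
    IsTest fun t x => φ t x - θ * χ t x :=
  ContDiff.sub hφ (contDiff_const.mul hχ)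

theorem ptd_sub_smul {φ χ : ℝ → En n → ℝ} (hφ : IsTest φ) (hχ : IsTest χ) (θ t : ℝ) (x : En n) :
    ptd (fun t x => φ t x - θ * χ t x) t x = ptd φ t x - θ * ptd χ t x := by
  have h1 := (hφ.contDiff_time x).differentiable two_ne_zero t
  have h2 := (hχ.contDiff_time x).differentiable two_ne_zero t
  rw [ptd, deriv_fun_sub h1 (h2.const_mul θ), deriv_const_mul θ h2]
  rfl

theorem genL_sub_smul (a : ℝ → En n → En n) (σm : ℝ → En n → Matrix (Fin n) (Fin d) ℝ)
    {φ χ : ℝ → En n → ℝ} (hφ : IsTest φ) (hχ : IsTest χ) (θ t : ℝ) (x : En n) :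
    genL a σm (fun t x => φ t x - θ * χ t x) t x = genL a σm φ t x - θ * genL a σm χ t x := by
  have h1 := hφ.contDiff_space t
  have h2 := hχ.contDiff_space t
  simp only [genL, pd_sub_smul (h1.differentiable two_ne_zero x) (h2.differentiable two_ne_zero x),
    pd2_sub_smul h1 h2, mul_sub, Finset.sum_sub_distrib, mul_left_comm _ θ, ← Finset.mul_sum]
  ring

theorem sigGrad_sub_smul (σm : ℝ → En n → Matrix (Fin n) (Fin d) ℝ)
    {φ χ : ℝ → En n → ℝ} (hφ : IsTest φ) (hχ : IsTest χ) (θ t : ℝ) (x : En n) :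
    sigGrad σm (fun t x => φ t x - θ * χ t x) t x =
      sigGrad σm φ t x - θ • sigGrad σm χ t x := by
  have h1 := hφ.contDiff_space t
  have h2 := hχ.contDiff_space t
  ext k
  simp [sigGrad, pd_sub_smul (h1.differentiable two_ne_zero x)
    (h2.differentiable two_ne_zero x), mul_sub, Finset.sum_sub_distrib, mul_left_comm _ θ,
    ← Finset.mul_sum]

end TestFunctions

section Weight

variable {n d : ℕ}

theorem hasDerivAt_max_sub_pow (c : ℝ) (k : ℕ) (r : ℝ) :
    HasDerivAt (fun r => max (r - c) 0 ^ (k + 2)) ((k + 2) * max (r - c) 0 ^ (k + 1)) r := by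
  have hpow : HasDerivAt (fun r => (r - c) ^ (k + 2)) ((k + 2) * (r - c) ^ (k + 1)) r := by
    refine (((hasDerivAt_id r).sub_const c).pow (k + 2)).congr_deriv ?_
    simp
  rcases lt_trichotomy r c with h | h | h
  · rw [max_eq_right (sub_nonpos.2 h.le), zero_pow (by simp), mul_zero]
    refine (hasDerivAt_const r (0 : ℝ)).congr_of_eventuallyEq ?_
    filter_upwards [Iio_mem_nhds h] with s hs
    rw [max_eq_right (sub_nonpos.2 (le_of_lt hs)), zero_pow (by simp)]
  · subst h
    have h1 : HasDerivWithinAt (fun s => max (s - r) 0 ^ (k + 2)) 0 (Iic r) r := by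
      refine (hasDerivWithinAt_const r (Iic r) (0 : ℝ)).congr (fun s hs => ?_) ?_
      · rw [max_eq_right (sub_nonpos.2 hs), zero_pow (by simp)]
      · simp
    have h2 : HasDerivWithinAt (fun s => max (s - r) 0 ^ (k + 2)) 0 (Ici r) r := by
      have h3 : HasDerivAt (fun s => (s - r) ^ (k + 2)) 0 r := by simpa using hpow
      refine h3.hasDerivWithinAt.congr (fun s hs => ?_) ?_
      · rw [max_eq_left (sub_nonneg.2 hs)]
      · simp
    have h3 := h1.union h2
    rw [Iic_union_Ici, hasDerivWithinAt_univ] at h3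
    simpa using h3
  · rw [max_eq_left (sub_nonneg.2 h.le)]
    refine hpow.congr_of_eventuallyEq ?_
    filter_upwards [Ioi_mem_nhds h] with s hs
    rw [max_eq_left (sub_nonneg.2 (le_of_lt hs))]

theorem contDiff_max_sub_pow (c : ℝ) (k : ℕ) :
    ContDiff ℝ k (fun r => max (r - c) 0 ^ (k + 1)) := by
  induction k with
  | zero =>
    rw [Nat.cast_zero, contDiff_zero]
    fun_prop
  | succ k ih =>
    rw [Nat.cast_succ, contDiff_succ_iff_deriv]
    refine ⟨fun r => (hasDerivAt_max_sub_pow c k r).differentiableAt, by simp, ?_⟩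
    rw [funext fun r => (hasDerivAt_max_sub_pow c k r).deriv]
    exact contDiff_const.mul ih

/-- A `C²` radial weight, constant on the ball of radius `K`. -/
def radialWeight (K : ℝ) (j : ℕ) (x : En n) : ℝ := 1 + max (‖x‖ ^ 2 - K ^ 2) 0 ^ (j + 3)

theorem contDiff_radialWeight (K : ℝ) (j : ℕ) :
    ContDiff ℝ 2 (radialWeight (n := n) K j) := by
  have h : ContDiff ℝ 2 fun r : ℝ => max (r - K ^ 2) 0 ^ (j + 3) :=
    (contDiff_max_sub_pow (K ^ 2) (j + 2)).of_le (by
      exact_mod_cast Nat.le_add_left 2 j)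
  exact contDiff_const.add (h.comp (contDiff_norm_sq ℝ))

theorem one_le_radialWeight (K : ℝ) (j : ℕ) (x : En n) : 1 ≤ radialWeight K j x := by
  have : 0 ≤ max (‖x‖ ^ 2 - K ^ 2) 0 ^ (j + 3) := pow_nonneg (le_max_right _ _) _
  rw [radialWeight]
  linarith

theorem radialWeight_le_of_norm_le {K : ℝ} (j : ℕ) {x y : En n}
    (h : ‖y‖ ≤ max K ‖x‖) : radialWeight K j y ≤ radialWeight K j x := by
  refine add_le_add le_rfl (pow_le_pow_left₀ (le_max_right _ _) ?_ _)
  rcases le_max_iff.1 h with h | h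
  · refine max_le (le_trans ?_ (le_max_right _ _)) (le_max_right _ _)
    have := pow_le_pow_left₀ (norm_nonneg _) h 2
    linarith
  · have := pow_le_pow_left₀ (norm_nonneg _) h 2
    exact max_le_max (by linarith) le_rfl

theorem exists_polynomial_le_radialWeight {K ρ : ℝ} {j : ℕ} (hρ : ρ ≤ 2 * j + 5) {C θ : ℝ}
    (hC : 0 ≤ C) (hθ : 0 < θ) :
    ∃ R, ∀ x : En n, R ≤ ‖x‖ → C * (1 + ‖x‖ ^ ρ) ≤ θ * radialWeight K j x := by
  refine ⟨max 1 (max (2 * |K|) (2 * C * 2 ^ (j + 3) / θ)), fun x hx => ?_⟩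
  obtain ⟨h1, h2⟩ := max_le_iff.1 hx
  obtain ⟨h2, h3⟩ := max_le_iff.1 h2
  set y := ‖x‖ with hy
  have h4 : y ^ ρ ≤ y ^ (2 * j + 5) := by
    rw [← Real.rpow_natCast]
    exact Real.rpow_le_rpow_of_exponent_le h1 (by push_cast; exact hρ)
  have h5 : 1 ≤ y ^ (2 * j + 5) := one_le_pow₀ h1
  have h6 : y ^ 2 / 2 ≤ max (y ^ 2 - K ^ 2) 0 := by
    refine le_trans ?_ (le_max_left _ _)
    nlinarith [sq_abs K, abs_nonneg K]
  have h7 : (y ^ 2 / 2) ^ (j + 3) ≤ radialWeight K j x := by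
    have := pow_le_pow_left₀ (by positivity) h6 (j + 3)
    rw [radialWeight]
    linarith
  have h8 : (y ^ 2 / 2) ^ (j + 3) = y * y ^ (2 * j + 5) / 2 ^ (j + 3) := by
    rw [div_pow, ← pow_mul]
    congr 1
    ring
  rw [div_le_iff₀ hθ] at h3
  calc C * (1 + y ^ ρ) ≤ C * (2 * y ^ (2 * j + 5)) := by gcongr; linarith
    _ = 2 * C * 2 ^ (j + 3) * (y ^ (2 * j + 5) / 2 ^ (j + 3)) := by field_simp
    _ ≤ y * θ * (y ^ (2 * j + 5) / 2 ^ (j + 3)) := by gcongr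
    _ = θ * (y ^ 2 / 2) ^ (j + 3) := by rw [h8]; ring
    _ ≤ θ * radialWeight K j x := by gcongr

theorem hasFDerivAt_max_norm_sq_pow (K : ℝ) (j : ℕ) (x : En n) :
    HasFDerivAt (fun y : En n => max (‖y‖ ^ 2 - K ^ 2) 0 ^ (j + 2))
      (((j + 2) * max (‖x‖ ^ 2 - K ^ 2) 0 ^ (j + 1)) • (2 : ℝ) • innerSL ℝ x) x := by
  have h := (hasDerivAt_max_sub_pow (K ^ 2) j (‖x‖ ^ 2)).comp_hasFDerivAt x
    (hasStrictFDerivAt_norm_sq x).hasFDerivAt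
  exact h.congr_fderiv (by rw [two_smul, two_smul])

theorem fderiv_radialWeight_single (K : ℝ) (j : ℕ) (x : En n) (i : Fin n) :
    fderiv ℝ (radialWeight K j) x (EuclideanSpace.single i 1) =
      (j + 3) * max (‖x‖ ^ 2 - K ^ 2) 0 ^ (j + 2) * (2 * x i) := by
  have h : HasFDerivAt (radialWeight K j) _ x :=
    (hasFDerivAt_max_norm_sq_pow K (j + 1) x).const_add 1
  rw [h.fderiv]
  generalize max (‖x‖ ^ 2 - K ^ 2) 0 = s
  simp only [_root_.smul_apply, innerSL_apply_apply, PiLp.inner_apply, smul_eq_mul]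
  simp [-mul_eq_mul_left_iff, -mul_eq_mul_right_iff]
  ring

theorem pd2_radialWeight (K : ℝ) (j : ℕ) (x : En n) (i l : Fin n) :
    pd2 (radialWeight K j) x i l =
      (j + 3) * (j + 2) * max (‖x‖ ^ 2 - K ^ 2) 0 ^ (j + 1) * (4 * (x i * x l)) +
      (j + 3) * max (‖x‖ ^ 2 - K ^ 2) 0 ^ (j + 2) * (2 * if i = l then 1 else 0) := by
  have h := (hasFDerivAt_max_norm_sq_pow K j x).const_mul (j + 3 : ℝ)
  have h1 : HasFDerivAt (fun y : En n => 2 * y l) _ x :=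
    (EuclideanSpace.proj l : En n →L[ℝ] ℝ).hasFDerivAt.const_mul 2
  rw [pd2, funext fun y => fderiv_radialWeight_single K j y l]
  have h2 := h.fun_mul h1
  rw [h2.fderiv]
  generalize max (‖x‖ ^ 2 - K ^ 2) 0 = s
  simp only [_root_.smul_apply, innerSL_apply_apply, PiLp.inner_apply, smul_eq_mul,
    _root_.add_apply]
  simp [eq_comm]
  split_ifs <;> ring

/-- The gradient of `radialWeight` at `x` is this multiple of `x`. -/
def radialSlope (K : ℝ) (j : ℕ) (x : En n) : ℝ :=
  2 * ((j + 3) * max (‖x‖ ^ 2 - K ^ 2) 0 ^ (j + 2))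

theorem pd_radialWeight (K : ℝ) (j : ℕ) (x : En n) (i : Fin n) :
    pd (radialWeight K j) x i = (radialSlope K j x • x) i := by
  rw [pd, fderiv_radialWeight_single]
  simp [radialSlope]
  ring

theorem sum_mul_transpose_pd2_radialWeight (K : ℝ) (j : ℕ) (x : En n)
    (M : Matrix (Fin n) (Fin d) ℝ) :
    ∑ i, ∑ l, (M * Mᵀ) i l * pd2 (radialWeight K j) x i l =
      4 * ((j + 3) * (j + 2) * max (‖x‖ ^ 2 - K ^ 2) 0 ^ (j + 1)) * ‖transMulVec M x‖ ^ 2 +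
      radialSlope K j x * frob M ^ 2 := by
  rw [sum_mul_transpose_mul, EuclideanSpace.real_norm_sq_eq (transMulVec M x), frob_sq,
    Finset.mul_sum,
    Finset.mul_sum, ← Finset.sum_add_distrib]
  refine Finset.sum_congr rfl fun k _ => ?_
  have h1 : transMulVec M x k ^ 2 = ∑ i, ∑ l, (M i k * x i) * (M l k * x l) := by
    rw [← Finset.sum_mul_sum, sq]
    rfl
  have h2 : ‖colVec M k‖ ^ 2 = ∑ i, ∑ l, M i k * M l k * if i = l then 1 else 0 := by
    rw [EuclideanSpace.real_norm_sq_eq]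
    refine Finset.sum_congr rfl fun i _ => ?_
    simp [colVec, sq]
  rw [h1, h2, Finset.mul_sum, Finset.mul_sum, ← Finset.sum_add_distrib]
  refine Finset.sum_congr rfl fun i _ => ?_
  rw [Finset.mul_sum, Finset.mul_sum, ← Finset.sum_add_distrib]
  refine Finset.sum_congr rfl fun l _ => ?_
  rw [pd2_radialWeight, radialSlope]
  ring

theorem pow_le_one_add_pow {s : ℝ} (hs : 0 ≤ s) {k m : ℕ} (h : k ≤ m) : s ^ k ≤ 1 + s ^ m := by
  rcases le_total s 1 with h1 | h1
  · exact (pow_le_one₀ hs h1).trans (by linarith [pow_nonneg hs m])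
  · exact (pow_le_pow_right₀ h1 h).trans (by linarith)

theorem genL_sigGrad_radialWeight_le (K : ℝ) (j : ℕ) {C : ℝ} (hC : 0 ≤ C) :
    ∃ C₁, 0 ≤ C₁ ∧ ∀ (a : ℝ → En n → En n) (σm : ℝ → En n → Matrix (Fin n) (Fin d) ℝ) (t : ℝ)
      (x : En n), ‖a t x‖ + frob (σm t x) ≤ C * (1 + ‖x‖) →
      genL a σm (fun _ => radialWeight K j) t x ≤ C₁ * radialWeight K j x ∧
      ‖sigGrad σm (fun _ => radialWeight K j) t x‖ ≤ C₁ * radialWeight K j x := by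
  set m : ℝ := j + 3 with hm
  have hm0 : 3 ≤ m := by
    rw [hm]
    linarith [Nat.cast_nonneg (α := ℝ) j]
  set L : ℝ := 1 + K ^ 2 with hL
  have hL1 : 1 ≤ L := by
    rw [hL]
    linarith [sq_nonneg K]
  refine ⟨8 * C * L * m + 32 * C ^ 2 * L ^ 2 * m ^ 2 + 4 * C ^ 2 * L * m, by positivity,
    fun a σm t x h => ?_⟩
  set s := max (‖x‖ ^ 2 - K ^ 2) 0 with hs
  have hs0 : 0 ≤ s := le_max_right _ _
  set y := ‖x‖ with hy
  have hy0 : 0 ≤ y := norm_nonneg x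
  have hys : 1 + y ^ 2 ≤ L * (1 + s) := by
    have h1 : y ^ 2 - K ^ 2 ≤ s := le_max_left _ _
    nlinarith [mul_nonneg (sq_nonneg K) hs0]
  set χ := radialWeight K j x with hχ
  have hχ1 : χ = 1 + s ^ (j + 3) := rfl
  have hw1 : s ^ (j + 2) * (1 + s) ≤ 2 * χ := by
    have h1 := pow_le_one_add_pow hs0 (show j + 2 ≤ j + 3 by omega)
    rw [hχ1]
    nlinarith [pow_succ s (j + 2)]
  have hw2 : s ^ (j + 1) * (1 + s) ^ 2 ≤ 4 * χ := by
    have h1 := pow_le_one_add_pow hs0 (show j + 1 ≤ j + 3 by omega)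
    have h2 := pow_le_one_add_pow hs0 (show j + 2 ≤ j + 3 by omega)
    rw [hχ1]
    nlinarith [pow_succ s (j + 2), pow_succ s (j + 1)]
  have hf := frob_nonneg (σm t x)
  have ha : ‖a t x‖ ≤ C * (1 + y) := by linarith
  have hσ : frob (σm t x) ≤ C * (1 + y) := by linarith [norm_nonneg (a t x)]
  have hsl : radialSlope K j x = 2 * (m * s ^ (j + 2)) := rfl
  have hsl0 : 0 ≤ radialSlope K j x := by
    rw [hsl]
    positivity
  have hCy : C * (1 + y) * y ≤ C * (2 * (L * (1 + s))) := by
    rw [mul_assoc]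
    refine mul_le_mul_of_nonneg_left ?_ hC
    nlinarith [sq_nonneg (1 - y)]
  have hCy2 : (C * (1 + y)) ^ 2 ≤ C ^ 2 * (2 * (L * (1 + s))) := by
    rw [mul_pow]
    refine mul_le_mul_of_nonneg_left ?_ (sq_nonneg C)
    nlinarith [sq_nonneg (1 - y)]
  have hkey : radialSlope K j x * (C * (1 + y) * y) ≤ 8 * C * L * m * χ :=
    calc radialSlope K j x * (C * (1 + y) * y)
        ≤ radialSlope K j x * (C * (2 * (L * (1 + s)))) := by gcongr
      _ = 4 * C * L * m * (s ^ (j + 2) * (1 + s)) := by rw [hsl]; ring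
      _ ≤ 4 * C * L * m * (2 * χ) := by gcongr
      _ = _ := by ring
  have hχ0 : 0 ≤ χ := by
    rw [hχ1]
    positivity
  have hgrad : ‖transMulVec (σm t x) x‖ ≤ C * (1 + y) * y :=
    (norm_transMulVec_le _ _).trans (by gcongr)
  constructor
  · have h1 : ∑ i, a t x i * pd (radialWeight K j) x i ≤ 8 * C * L * m * χ := by
      have h2 : ∑ i, a t x i * pd (radialWeight K j) x i =
          radialSlope K j x * inner ℝ (a t x) x := by
        simp only [pd_radialWeight]
        rw [PiLp.inner_apply, Finset.mul_sum]
        refine Finset.sum_congr rfl fun i _ => ?_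
        simp
        ring
      rw [h2]
      refine le_trans (mul_le_mul_of_nonneg_left ?_ hsl0) hkey
      exact (real_inner_le_norm _ _).trans (by gcongr)
    have h3 : 4 * ((j + 3) * (j + 2) * s ^ (j + 1)) * ‖transMulVec (σm t x) x‖ ^ 2 ≤
        64 * C ^ 2 * L ^ 2 * m ^ 2 * χ := by
      have h4 : ‖transMulVec (σm t x) x‖ ^ 2 ≤ (C * (2 * (L * (1 + s)))) ^ 2 :=
        pow_le_pow_left₀ (norm_nonneg _) (hgrad.trans hCy) 2
      calc 4 * ((j + 3) * (j + 2) * s ^ (j + 1)) * ‖transMulVec (σm t x) x‖ ^ 2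
          ≤ 4 * (m * m * s ^ (j + 1)) * (C * (2 * (L * (1 + s)))) ^ 2 := by
            gcongr
            rw [hm]
            linarith
        _ = 16 * C ^ 2 * L ^ 2 * m ^ 2 * (s ^ (j + 1) * (1 + s) ^ 2) := by ring
        _ ≤ 16 * C ^ 2 * L ^ 2 * m ^ 2 * (4 * χ) := by gcongr
        _ = _ := by ring
    have h5 : radialSlope K j x * frob (σm t x) ^ 2 ≤ 8 * C ^ 2 * L * m * χ :=
      calc radialSlope K j x * frob (σm t x) ^ 2
          ≤ radialSlope K j x * (C ^ 2 * (2 * (L * (1 + s)))) := by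
            refine mul_le_mul_of_nonneg_left ?_ hsl0
            exact (pow_le_pow_left₀ hf hσ 2).trans hCy2
        _ = 4 * C ^ 2 * L * m * (s ^ (j + 2) * (1 + s)) := by rw [hsl]; ring
        _ ≤ 4 * C ^ 2 * L * m * (2 * χ) := by gcongr
        _ = _ := by ring
    rw [genL, sum_mul_transpose_pd2_radialWeight]
    linarith
  · rw [sigGrad_eq σm _ t x (pd_radialWeight K j x)]
    have h1 : transMulVec (σm t x) (radialSlope K j x • x) =
        radialSlope K j x • transMulVec (σm t x) x := by
      ext k
      simp [transMulVec_apply, inner_smul_right]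
    rw [h1, norm_smul, Real.norm_eq_abs, abs_of_nonneg hsl0]
    have h2 := (mul_le_mul_of_nonneg_left hgrad hsl0).trans hkey
    have h3 : 0 ≤ (32 * C ^ 2 * L ^ 2 * m ^ 2 + 4 * C ^ 2 * L * m) * χ := by positivity
    linarith

end Weight

section TimeWeight

variable {n d : ℕ}

/-- A positive strict supersolution of the linearized equation, growing faster than a given
power and decreasing along maps that do not increase the norm outside a ball. -/
theorem exists_weight (K T ρ₀ kf : ℝ) {C : ℝ} (hC : 0 ≤ C) (hkf : 0 ≤ kf) :
    ∃ (g : ℝ → En n → ℝ) (C₁ : ℝ), 0 ≤ C₁ ∧ IsTest g ∧ (∀ t x, 0 < g t x) ∧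
      (∀ t x y, ‖y‖ ≤ max K ‖x‖ → g t y ≤ g t x) ∧
      (∀ ρ ≤ ρ₀, ∀ D, 0 ≤ D → ∀ θ, 0 < θ → ∃ R, ∀ t ∈ Icc 0 T, ∀ x, R ≤ ‖x‖ →
        D * (1 + ‖x‖ ^ ρ) ≤ θ * g t x) ∧
      ∀ (a : ℝ → En n → En n) (σm : ℝ → En n → Matrix (Fin n) (Fin d) ℝ) (t : ℝ)
        (x : En n), ‖a t x‖ + frob (σm t x) ≤ C * (1 + ‖x‖) →
        genL a σm g t x ≤ C₁ * g t x ∧ ‖sigGrad σm g t x‖ ≤ C₁ * g t x ∧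
        ptd g t x = -((C₁ + kf + kf * C₁ + 1) * g t x) := by
  obtain ⟨j, hj⟩ := exists_nat_ge ρ₀
  obtain ⟨C₁, hC₁, hb⟩ := genL_sigGrad_radialWeight_le (n := n) (d := d) K j hC
  set μ := C₁ + kf + kf * C₁ + 1 with hμ
  have hμ0 : 0 < μ := by positivity
  have hr : IsTest fun (_ : ℝ) => radialWeight (n := n) K j :=
    (contDiff_radialWeight K j).comp contDiff_snd
  have h0 : IsTest fun (_ : ℝ) (_ : En n) => (0 : ℝ) := contDiff_const
  have hpos : ∀ x : En n, 0 < radialWeight K j x := fun x =>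
    zero_lt_one.trans_le (one_le_radialWeight K j x)
  refine ⟨fun t x => Real.exp (-μ * t) * radialWeight K j x, C₁, hC₁, ?_, fun t x => ?_,
    fun t x y h => ?_, fun ρ hρ D hD θ hθ => ?_, fun a σm t x h => ?_⟩
  · exact (Real.contDiff_exp.comp (contDiff_const.mul contDiff_fst)).mul hr
  · exact mul_pos (Real.exp_pos _) (hpos x)
  · exact mul_le_mul_of_nonneg_left (radialWeight_le_of_norm_le j h) (Real.exp_pos _).le
  · obtain ⟨R, hR⟩ := exists_polynomial_le_radialWeight (n := n) (K := K) (ρ := ρ) (j := j)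
      (by linarith [Nat.cast_nonneg (α := ℝ) j]) hD (mul_pos hθ (Real.exp_pos (-μ * T)))
    refine ⟨R, fun t ht x hx => (hR x hx).trans ?_⟩
    rw [mul_assoc]
    have := (hpos x).le
    have h2 : -μ * T ≤ -μ * t := by nlinarith [ht.2]
    exact mul_le_mul_of_nonneg_left
      (mul_le_mul_of_nonneg_right (Real.exp_le_exp.2 h2) this) hθ.le
  · have hg : (fun x => Real.exp (-μ * t) * radialWeight (n := n) K j x) =
        (fun x : En n => (0 : ℝ) - -Real.exp (-μ * t) * radialWeight K j x) := by
      ext x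
      ring
    obtain ⟨h1, h2⟩ := hb a σm t x h
    have hz : genL a σm (fun _ _ => 0) t x = 0 := by simp [genL, pd, pd2]
    have hz' : sigGrad σm (fun _ _ => 0) t x = 0 := by
      ext k
      simp [sigGrad, pd]
    have e := (Real.exp_pos (-μ * t)).le
    refine ⟨?_, ?_, ?_⟩
    · have h3 := genL_sub_smul a σm h0 hr (-Real.exp (-μ * t)) t x
      have h4 : genL a σm (fun t x => Real.exp (-μ * t) * radialWeight K j x) t x = genL a σm
          (fun _ x => (0 : ℝ) - -Real.exp (-μ * t) * radialWeight K j x) t x := by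
        simp only [genL, hg]
      rw [h4, h3, hz]
      nlinarith
    · have h3 := sigGrad_sub_smul σm h0 hr (-Real.exp (-μ * t)) t x
      have h4 : sigGrad σm (fun t x => Real.exp (-μ * t) * radialWeight K j x) t x = sigGrad σm
          (fun _ x => (0 : ℝ) - -Real.exp (-μ * t) * radialWeight K j x) t x := by
        simp only [sigGrad, hg]
      rw [h4, h3, hz', neg_smul, sub_neg_eq_add, zero_add, norm_smul, Real.norm_eq_abs,
        abs_of_nonneg e]
      nlinarith
    · have h3 : HasDerivAt (fun s => Real.exp (-μ * s) * radialWeight K j x)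
          (Real.exp (-μ * t) * (-μ * 1) * radialWeight K j x) t :=
        (((hasDerivAt_id t).const_mul (-μ)).exp).mul_const _
      rw [ptd, h3.deriv]
      ring

end TimeWeight

section Ratio

theorem exists_ratio_max {X : Type*} [TopologicalSpace X] {S : Set X}
    {D g : X → ℝ} (hD : UpperSemicontinuousOn D S) (hg : ContinuousOn g S)
    (hg0 : ∀ p ∈ S, 0 < g p)
    (hbd : ∀ θ > 0, ∃ B ⊆ S, IsCompact B ∧ ∀ p ∈ S, p ∉ B → D p < θ * g p) {p₀ : X}
    (hp₀ : p₀ ∈ S) (hDp₀ : 0 < D p₀) :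
    ∃ θ > 0, (∀ p ∈ S, D p ≤ θ * g p) ∧ ∃ Z, IsCompact Z ∧ Z.Nonempty ∧
      ∀ p, p ∈ Z ↔ p ∈ S ∧ D p = θ * g p := by
  have husc : UpperSemicontinuousOn (fun p => D p / g p) S := by
    intro p hp y hy
    have h1 := (hD.add (hg.const_mul (-y)).upperSemicontinuousOn) p hp 0 (by
      rw [div_lt_iff₀ (hg0 p hp)] at hy
      linarith)
    filter_upwards [h1, self_mem_nhdsWithin] with q hq hqS
    rw [div_lt_iff₀ (hg0 q hqS)]
    linarith
  have hθ₀ : 0 < D p₀ / g p₀ := div_pos hDp₀ (hg0 _ hp₀)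
  obtain ⟨B, hBS, hB, hout⟩ := hbd _ hθ₀
  have hp₀B : p₀ ∈ B := by
    by_contra h
    have := hout p₀ hp₀ h
    rw [div_mul_cancel₀ _ (hg0 _ hp₀).ne'] at this
    exact this.false
  obtain ⟨z, hz, hmax⟩ := (husc.mono hBS).exists_isMaxOn ⟨p₀, hp₀B⟩ hB
  have hle : D p₀ / g p₀ ≤ D z / g z := hmax hp₀B
  have hle' : ∀ p ∈ S, D p ≤ D z / g z * g p := by
    intro p hp
    by_cases h : p ∈ B
    · rw [← div_le_iff₀ (hg0 p hp)]
      exact hmax h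
    · exact (hout p hp h).le.trans (mul_le_mul_of_nonneg_right hle (hg0 p hp).le)
  refine ⟨D z / g z, hθ₀.trans_le hle, hle', _,
    (husc.mono hBS).isCompact_inter_preimage_Ici hB (D z / g z),
    ⟨z, hz, mem_preimage.2 (mem_Ici.2 le_rfl)⟩, fun p => ?_⟩
  constructor
  · rintro ⟨h1, h2⟩
    exact ⟨hBS h1, le_antisymm (hle' p (hBS h1)) ((le_div_iff₀ (hg0 p (hBS h1))).1 h2)⟩
  · rintro ⟨h1, h2⟩
    refine ⟨?_, (le_div_iff₀ (hg0 p h1)).2 h2.ge⟩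
    by_contra h
    have h3 := hout p h1 h
    have h4 := mul_le_mul_of_nonneg_right hle (hg0 p h1).le
    linarith

end Ratio

section Intervention

variable {n d : ℕ} {T : ℝ}

theorem exists_isLocalMaxOn_test_sub {v : ℝ → En n → ℝ}
    (hv : LowerSemicontinuousOn (fun p : ℝ × En n => v p.1 p.2) (Strip n T)) {p : ℝ × En n}
    (hp : p ∈ Strip n T) {s : Set (ℝ × En n)} (hs : s ∈ 𝓝[Strip n T] p) :
    ∃ q ∈ s ∩ Strip n T, v q.1 q.2 ≤ v p.1 p.2 ∧ ∃ φ : ℝ → En n → ℝ, IsTest φ ∧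
      φ q.1 q.2 = v q.1 q.2 ∧
      IsLocalMaxOn (fun p : ℝ × En n => φ p.1 p.2 - v p.1 p.2) (Strip n T) q := by
  let N : ℝ × En n → ℝ := fun q => (q.1 - p.1) ^ 2 + ‖q.2 - p.2‖ ^ 2
  have hN : ContDiff ℝ 2 N := by
    have h1 : ContDiff ℝ 2 fun q : ℝ × En n => q.2 - p.2 := contDiff_snd.sub contDiff_const
    exact ((contDiff_fst.sub contDiff_const).pow 2).add (h1.norm_sq ℝ)
  have hNc : Continuous N := hN.continuous
  have hlow : ∀ᶠ q in 𝓝[Strip n T] p, q ∈ s ∧ v p.1 p.2 - 1 < v q.1 q.2 :=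
    (show ∀ᶠ q in 𝓝[Strip n T] p, q ∈ s from hs).and (hv p hp _ (sub_one_lt _))
  obtain ⟨r, hr, hball⟩ := Metric.mem_nhdsWithin_iff.1 hlow
  have hdist : ∀ q, N q ≤ (r / 2) ^ 2 → q ∈ Metric.ball p r := by
    intro q hq
    have h1 : |q.1 - p.1| ≤ r / 2 := abs_le_of_sq_le_sq
      (by nlinarith [sq_nonneg ‖q.2 - p.2‖]) (by positivity)
    have h2 : ‖q.2 - p.2‖ ≤ r / 2 := (abs_le_of_sq_le_sq
      (by nlinarith [sq_nonneg (q.1 - p.1)]) (by positivity)).trans' (le_abs_self _)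
    rw [Metric.mem_ball, Prod.dist_eq, Real.dist_eq, dist_eq_norm]
    exact max_lt (by linarith) (by linarith)
  have hclosed : IsClosed (Strip n T) := isClosed_Icc.prod isClosed_univ
  set B : Set (ℝ × En n) := Strip n T ∩ {q | N q ≤ (r / 2) ^ 2} with hB
  have hBc : IsCompact B :=
    Metric.isCompact_of_isClosed_isBounded
      (hclosed.inter (isClosed_le hNc continuous_const))
      (Metric.isBounded_ball.subset fun q hq => hdist q hq.2)
  have hNp : N p = 0 := by simp [N]
  have hpB : p ∈ B := ⟨hp, by
    rw [mem_ofPred_eq, hNp]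
    positivity⟩
  set k := (2 / r) ^ 2 with hk
  have hlsc : LowerSemicontinuousOn (fun q => v q.1 q.2 + k * N q) B :=
    (hv.mono inter_subset_left).add
      (continuous_const.mul hNc).continuousOn.lowerSemicontinuousOn
  obtain ⟨q, hqB, hmin⟩ := hlsc.exists_isMinOn ⟨p, hpB⟩ hBc
  have hqs := hball ⟨hdist q hqB.2, hqB.1⟩
  have h1 : v q.1 q.2 + k * N q ≤ v p.1 p.2 := by
    have : v q.1 q.2 + k * N q ≤ v p.1 p.2 + k * N p := hmin hpB
    simpa [hNp] using this
  have hN0 : 0 ≤ N q := by positivity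
  have hk0 : 0 ≤ k := sq_nonneg _
  refine ⟨q, ⟨hqs.1, hqB.1⟩, by nlinarith,
    fun t x => v q.1 q.2 + k * N q - k * N (t, x), ?_, by simp, ?_⟩
  · exact contDiff_const.sub (contDiff_const.mul hN)
  have hNq : N q < (r / 2) ^ 2 := by
    have h2 : k * N q < 1 := by linarith [hqs.2]
    have h3 : k * (r / 2) ^ 2 = 1 := by
      rw [hk]
      field_simp
    by_contra! h
    nlinarith
  filter_upwards [nhdsWithin_le_nhds ((isOpen_lt hNc continuous_const).mem_nhds hNq),
    self_mem_nhdsWithin] with q' hq' hq'S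
  have : v q.1 q.2 + k * N q ≤ v q'.1 q'.2 + k * N q' := hmin ⟨hq'S, le_of_lt hq'⟩
  change v q.1 q.2 + k * N q - k * N q' - v q'.1 q'.2 ≤
    v q.1 q.2 + k * N q - k * N q - v q.1 q.2
  linarith

variable {U : Type} {Γ : ℝ → En n → U → En n} {ℓ : ℝ → En n → U → ℝ} {K δ : ℝ}

theorem PolyGrowth.bddAbove_range {v : ℝ → En n → ℝ} (hv : PolyGrowth T v) (hδ : 0 < δ)
    (hΓb : ∀ t ∈ Icc (0:ℝ) T, ∀ (x : En n) (b : U), ‖Γ t x b‖ ≤ max K ‖x‖)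
    (hℓ : ∀ t ∈ Icc (0:ℝ) T, ∀ (x : En n) (b : U), δ ≤ ℓ t x b)
    {t : ℝ} (ht : t ∈ Icc 0 T) (x : En n) :
    BddAbove (range fun b => v t (Γ t x b) - ℓ t x b) := by
  obtain ⟨C, hC, ρ, hρ, hb⟩ := hv
  refine ⟨C * (1 + max K ‖x‖ ^ ρ), ?_⟩
  rintro _ ⟨b, rfl⟩
  have h1 := (le_abs_self _).trans (hb t ht (Γ t x b))
  have h2 := Real.rpow_le_rpow (norm_nonneg _) (hΓb t ht x b) hρ.le
  have h3 := hℓ t ht x b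
  dsimp only
  nlinarith

theorem IsSuper.mop_le [TopologicalSpace U] [Nonempty U] {a : ℝ → En n → En n}
    {σm : ℝ → En n → Matrix (Fin n) (Fin d) ℝ} {f : ℝ → En n → ℝ → Ed d → ℝ} {ψ : En n → ℝ}
    {v : ℝ → En n → ℝ} (hv : IsSuper T Γ ℓ a σm f ψ v) (hvpg : PolyGrowth T v) (hδ : 0 < δ)
    (hΓc : ContinuousOn (fun p : ℝ × En n × U => Γ p.1 p.2.1 p.2.2)
      (Icc 0 T ×ˢ (univ : Set (En n × U))))
    (hΓb : ∀ t ∈ Icc (0:ℝ) T, ∀ (x : En n) (b : U), ‖Γ t x b‖ ≤ max K ‖x‖)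
    (hℓc : ContinuousOn (fun p : ℝ × En n × U => ℓ p.1 p.2.1 p.2.2)
      (Icc 0 T ×ˢ (univ : Set (En n × U))))
    (hℓ : ∀ t ∈ Icc (0:ℝ) T, ∀ (x : En n) (b : U), δ ≤ ℓ t x b)
    {t : ℝ} (ht : t ∈ Ico 0 T) (x : En n) : Mop Γ ℓ v t x ≤ v t x := by
  refine ciSup_le fun b => ?_
  by_contra! hlt
  obtain ⟨c, hc1, hc2⟩ := exists_between hlt
  have hp : (t, x) ∈ Strip n T := ⟨Ico_subset_Icc_self ht, mem_univ _⟩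
  have hemb : ContinuousOn (fun q : ℝ × En n => (q.1, q.2, b)) (Strip n T) := by fun_prop
  have hmaps : MapsTo (fun q : ℝ × En n => (q.1, q.2, b)) (Strip n T)
      (Icc 0 T ×ˢ (univ : Set (En n × U))) := fun q hq => ⟨hq.1, mem_univ _⟩
  have hΓ' : ContinuousOn (fun q : ℝ × En n => (q.1, Γ q.1 q.2 b)) (Strip n T) :=
    continuousOn_fst.prodMk (hΓc.comp hemb hmaps)
  have hℓ' : ContinuousOn (fun q : ℝ × En n => ℓ q.1 q.2 b) (Strip n T) := hℓc.comp hemb hmaps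
  have hlsc : LowerSemicontinuousOn
      (fun q : ℝ × En n => v q.1 (Γ q.1 q.2 b) + -ℓ q.1 q.2 b) (Strip n T) :=
    (LowerSemicontinuousOn.comp (f := fun p : ℝ × En n => v p.1 p.2) hv.1 hΓ'
      fun q hq => ⟨hq.1, mem_univ _⟩).add hℓ'.neg.lowerSemicontinuousOn
  have hev : ∀ᶠ q in 𝓝[Strip n T] (t, x), q.1 < T ∧ c < v q.1 (Γ q.1 q.2 b) + -ℓ q.1 q.2 b :=
    (eventually_nhdsWithin_of_eventually_nhds
      ((continuous_fst.tendsto (t, x)).eventually (gt_mem_nhds ht.2))).and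
      (hlsc _ hp c (by simpa [sub_eq_add_neg] using hc2))
  obtain ⟨q, ⟨⟨hqT, hqc⟩, hqS⟩, hqv, φ, hφ, hφq, hmax⟩ :=
    exists_isLocalMaxOn_test_sub hv.1 hp hev
  have h1 := (le_min_iff.1 (hv.2.2 q.1 ⟨hqS.1.1, hqT⟩ q.2 φ hφ hφq hmax)).1
  have h2 := le_ciSup (hvpg.bddAbove_range hδ hΓb hℓ hqS.1 q.2) b
  rw [Mop] at h1
  dsimp only at hqv
  linarith

end Intervention

section ContactPoint

variable {n d : ℕ} {T : ℝ} {U : Type} {Γ : ℝ → En n → U → En n} {ℓ : ℝ → En n → U → ℝ} {K δ : ℝ}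

theorem eventually_mop_le [TopologicalSpace U] [CompactSpace U] [Nonempty U] {u : ℝ → En n → ℝ}
    (hu : UpperSemicontinuousOn (fun p : ℝ × En n => u p.1 p.2) (Strip n T))
    (hΓc : ContinuousOn (fun p : ℝ × En n × U => Γ p.1 p.2.1 p.2.2)
      (Icc 0 T ×ˢ (univ : Set (En n × U))))
    (hℓc : ContinuousOn (fun p : ℝ × En n × U => ℓ p.1 p.2.1 p.2.2)
      (Icc 0 T ×ˢ (univ : Set (En n × U))))
    {p : ℝ × En n} (hp : p ∈ Strip n T) {y : ℝ}
    (hlt : ∀ b, u p.1 (Γ p.1 p.2 b) - ℓ p.1 p.2 b < y) :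
    ∃ c < y, ∀ᶠ q in 𝓝[Strip n T] p, Mop Γ ℓ u q.1 q.2 ≤ c := by
  set S : Set (ℝ × En n × U) := Icc 0 T ×ˢ univ with hS
  have husc : UpperSemicontinuousOn
      (fun q : ℝ × En n × U => u q.1 (Γ q.1 q.2.1 q.2.2) + -ℓ q.1 q.2.1 q.2.2) S :=
    (UpperSemicontinuousOn.comp (f := fun p : ℝ × En n => u p.1 p.2) hu
      (continuousOn_fst.prodMk hΓc) fun q hq => ⟨hq.1, mem_univ _⟩).add
      hℓc.neg.upperSemicontinuousOn
  have hslice : UpperSemicontinuousOn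
      (fun b => u p.1 (Γ p.1 p.2 b) + -ℓ p.1 p.2 b) univ :=
    UpperSemicontinuousOn.comp (g := fun b => (p.1, p.2, b))
      (f := fun q : ℝ × En n × U => u q.1 (Γ q.1 q.2.1 q.2.2) + -ℓ q.1 q.2.1 q.2.2) husc
      (by fun_prop) fun b _ => ⟨hp.1, mem_univ _⟩
  obtain ⟨b₀, -, hb₀⟩ := hslice.exists_isMaxOn univ_nonempty isCompact_univ
  obtain ⟨c, hc, hcy⟩ := exists_between (hlt b₀)
  refine ⟨c, hcy, ?_⟩
  have htube : ∀ᶠ q in 𝓝 p, ∀ b ∈ (univ : Set U), q ∈ Strip n T →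
      u q.1 (Γ q.1 q.2 b) + -ℓ q.1 q.2 b < c := by
    refine isCompact_univ.eventually_forall_of_forall_eventually fun b _ => ?_
    have h1 : u p.1 (Γ p.1 p.2 b) + -ℓ p.1 p.2 b < c := by
      have : _ ≤ u p.1 (Γ p.1 p.2 b₀) + -ℓ p.1 p.2 b₀ := hb₀ (mem_univ b)
      linarith
    have h2 := eventually_nhdsWithin_iff.1 (husc (p.1, p.2, b) ⟨hp.1, mem_univ _⟩ c h1)
    have h3 : Continuous fun z : (ℝ × En n) × U => (z.1.1, z.1.2, z.2) := by fun_prop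
    filter_upwards [(h3.tendsto (p, b)).eventually h2] with z hz hzS
    exact hz ⟨hzS.1, mem_univ _⟩
  filter_upwards [eventually_nhdsWithin_of_eventually_nhds htube, self_mem_nhdsWithin] with q hq hqS
  refine ciSup_le fun b => ?_
  have := hq b (mem_univ b) hqS
  linarith

/-- Among the maximum points of `(u - v) / g` there is one where intervening is strictly
suboptimal for `u`. -/
theorem exists_contact_mop_lt [TopologicalSpace U] [Nonempty U]
    {a : ℝ → En n → En n}
    {σm : ℝ → En n → Matrix (Fin n) (Fin d) ℝ} {f : ℝ → En n → ℝ → Ed d → ℝ} {ψ : En n → ℝ}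
    {u v : ℝ → En n → ℝ} (hv : IsSuper T Γ ℓ a σm f ψ v) (hu : IsSub T Γ ℓ a σm f ψ u)
    (hvpg : PolyGrowth T v) (hδ : 0 < δ)
    (hΓc : ContinuousOn (fun p : ℝ × En n × U => Γ p.1 p.2.1 p.2.2)
      (Icc 0 T ×ˢ (univ : Set (En n × U))))
    (hΓb : ∀ t ∈ Icc (0:ℝ) T, ∀ (x : En n) (b : U), ‖Γ t x b‖ ≤ max K ‖x‖)
    (hℓc : ContinuousOn (fun p : ℝ × En n × U => ℓ p.1 p.2.1 p.2.2)
      (Icc 0 T ×ˢ (univ : Set (En n × U))))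
    (hℓ : ∀ t ∈ Icc (0:ℝ) T, ∀ (x : En n) (b : U), δ ≤ ℓ t x b)
    {g : ℝ → En n → ℝ} (hg0 : ∀ t x, 0 < g t x)
    (hgm : ∀ t x y, ‖y‖ ≤ max K ‖x‖ → g t y ≤ g t x) {θ : ℝ} (hθ : 0 < θ)
    (hle : ∀ p ∈ Strip n T, u p.1 p.2 - v p.1 p.2 ≤ θ * g p.1 p.2) {Z : Set (ℝ × En n)}
    (hZ : IsCompact Z) (hZne : Z.Nonempty)
    (hZiff : ∀ p, p ∈ Z ↔ p ∈ Strip n T ∧ u p.1 p.2 - v p.1 p.2 = θ * g p.1 p.2) :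
    ∃ p ∈ Strip n T, p.1 < T ∧ u p.1 p.2 - v p.1 p.2 = θ * g p.1 p.2 ∧
      ∀ b, u p.1 (Γ p.1 p.2 b) - ℓ p.1 p.2 b < u p.1 p.2 := by
  obtain ⟨p, hpZ, hmax⟩ := (hu.1.mono fun p hp => ((hZiff p).1 hp).1).exists_isMaxOn hZne hZ
  obtain ⟨hpS, hp⟩ := (hZiff p).1 hpZ
  have hpos : 0 < θ * g p.1 p.2 := mul_pos hθ (hg0 _ _)
  have hpT : p.1 < T := by
    refine hpS.1.2.lt_of_ne fun h => ?_
    rw [h] at hp hpos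
    linarith [hu.2.1 p.2, hv.2.1 p.2]
  refine ⟨p, hpS, hpT, hp, fun b => ?_⟩
  by_contra! h
  have hM := hv.mop_le hvpg hδ hΓc hΓb hℓc hℓ ⟨hpS.1.1, hpT⟩ p.2
  have hb : v p.1 (Γ p.1 p.2 b) - ℓ p.1 p.2 b ≤ Mop Γ ℓ v p.1 p.2 :=
    le_ciSup (hvpg.bddAbove_range hδ hΓb hℓ hpS.1 p.2) b
  have h1 : (p.1, Γ p.1 p.2 b) ∈ Strip n T := ⟨hpS.1, mem_univ _⟩
  have h2 := hle _ h1
  have h3 := mul_le_mul_of_nonneg_left (hgm p.1 p.2 _ (hΓb p.1 hpS.1 p.2 b)) hθ.le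
  dsimp only at h2
  have h4 : u p.1 (Γ p.1 p.2 b) ≤ u p.1 p.2 := hmax ((hZiff _).2 ⟨h1, by
    dsimp only
    linarith⟩)
  linarith [hℓ p.1 hpS.1 p.2 b]

end ContactPoint

section Penalization

variable {E : Type*} [NormedAddCommGroup E] [InnerProductSpace ℝ E] [FiniteDimensional ℝ E]

theorem exists_penalized_contact {K : Set E} (hK : IsCompact K) {u w : E → ℝ}
    (hu : UpperSemicontinuousOn u K) (hw : UpperSemicontinuousOn w K) {z : E} (hz : z ∈ K)
    (huw : u z + w z = 0) {D : ℝ} (hD : ∀ P ∈ K, ‖P - z‖ ≤ D) {lam ε δ : ℝ} (hlam : 1 ≤ lam)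
    (hε : 0 ≤ ε) (hδ : 0 < δ) (hδ' : δ ≤ 1 / 2) {L : E →L[ℝ] E}
    (hsymm : ∀ x y, inner ℝ (L x) y = inner ℝ (L y) x) (hpos : ∀ x, 0 ≤ inner ℝ (L x) x)
    (hnorm : ∀ x, ‖L x‖ ≤ lam * ‖x‖) :
    ∃ (X Y P Q p r : E) (A B : E →L[ℝ] E), P ∈ K ∧ Q ∈ K ∧ ‖p‖ < δ ∧ ‖r‖ < δ ∧
      lam / 2 * ‖X - P‖ ^ 2 + lam / 2 * ‖Y - Q‖ ^ 2 + 1 / 2 * inner ℝ (L (X - Y)) (X - Y) +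
        ε * ‖X - z‖ ^ 2 ≤ 2 * (u P + w Q) + 4 * δ * (D + 1) ∧
      (∀ η > 0, ∀ᶠ P' in 𝓝[K] P, u P' ≤ u P +
        inner ℝ (L (X - Y) + (2 * ε) • (X - z) + p) (P' - P) +
        1 / 2 * inner ℝ (A (P' - P)) (P' - P) + η * ‖P' - P‖ ^ 2) ∧
      (∀ η > 0, ∀ᶠ Q' in 𝓝[K] Q, w Q' ≤ w Q + inner ℝ (-L (X - Y) + r) (Q' - Q) +
        1 / 2 * inner ℝ (B (Q' - Q)) (Q' - Q) + η * ‖Q' - Q‖ ^ 2) ∧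
      ∀ h k, 1 / 2 * inner ℝ (A h) h + 1 / 2 * inner ℝ (B k) k ≤
        1 / 2 * inner ℝ (L (h - k)) (h - k) + ε * ‖h‖ ^ 2 := by
  have hquad : ∀ h k : E, inner ℝ (L (h - k)) (h - k) ≤ 2 * lam * (‖h‖ ^ 2 + ‖k‖ ^ 2) := by
    intro h k
    have h1 : inner ℝ (L (h - k)) (h - k) ≤ lam * ‖h - k‖ ^ 2 := by
      refine (real_inner_le_norm _ _).trans ?_
      nlinarith [hnorm (h - k), norm_nonneg (h - k)]
    have h2 := parallelogram_law_with_norm ℝ h k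
    nlinarith [mul_self_nonneg ‖h + k‖]
  obtain ⟨X, Y, P, Q, p, r, A, B, hP, hQ, hp, hr, hmax, hA, hB, hAB⟩ :=
    exists_doubled_contact ⟨z, hz⟩ hK hu hw (lam := lam) (C := lam + 2 * ε)
      (H := fun X Y => 1 / 2 * inner ℝ (L (X - Y)) (X - Y) + ε * ‖X - z‖ ^ 2)
      (D₁ := fun X Y => L (X - Y) + (2 * ε) • (X - z)) (D₂ := fun X Y => -L (X - Y))
      (q := fun h k => 1 / 2 * inner ℝ (L (h - k)) (h - k) + ε * ‖h‖ ^ 2)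
      (by linarith) (by linarith)
      (fun X Y h k => by
        have h1 : X + h - (Y + k) = (X - Y) + (h - k) := by abel
        have h2 : X + h - z = (X - z) + h := by abel
        have h3 := hsymm (h - k) (X - Y)
        rw [h1, h2, norm_add_sq_real, map_add, inner_add_left, inner_add_right, inner_add_right, h3,
          inner_add_left, inner_smul_left, inner_neg_left]
        simp only [RCLike.conj_to_real]
        linear_combination inner_sub_right (𝕜 := ℝ) (L (X - Y)) h k)
      (fun h k => by
        have h1 := hquad h k
        have h2 := hpos (h - k)
        have h3 := sq_nonneg ‖h‖
        have h4 := sq_nonneg ‖k‖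
        rw [abs_of_nonneg (by positivity)]
        nlinarith)
      (fun t h k => by
        rw [← smul_sub, map_smul, inner_smul_left, inner_smul_right, norm_smul, mul_pow,
          Real.norm_eq_abs, sq_abs]
        simp only [RCLike.conj_to_real]
        ring)
      (fun X Y X' Y' => by
        have h1 : L (X - Y) + (2 * ε) • (X - z) - (L (X' - Y') + (2 * ε) • (X' - z)) =
            L ((X - X') - (Y - Y')) + (2 * ε) • (X - X') := by
          simp only [map_sub, smul_sub]
          abel
        rw [h1]
        refine (norm_add_le _ _).trans ?_
        rw [norm_smul, Real.norm_eq_abs, abs_of_nonneg (by positivity)]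
        have h2 := norm_sub_le (X - X') (Y - Y')
        nlinarith [hnorm ((X - X') - (Y - Y')), norm_nonneg (X - X'), norm_nonneg (Y - Y')])
      (fun X Y X' Y' => by
        have h1 : -L (X - Y) - -L (X' - Y') = -L ((X - X') - (Y - Y')) := by
          simp only [map_sub]
          abel
        rw [h1, norm_neg]
        have h2 := norm_sub_le (X - X') (Y - Y')
        nlinarith [hnorm ((X - X') - (Y - Y')), norm_nonneg (X - X'), norm_nonneg (Y - Y')])
      (fun X Y => by
        have := hpos (X - Y)
        positivity)
      hδ
  refine ⟨X, Y, P, Q, p, r, A, B, hP, hQ, hp, hr, ?_, hA, hB, hAB⟩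
  have hlin : ∀ s R W : E, ‖s‖ < δ → R ∈ K →
      inner ℝ s z - inner ℝ s W ≤ lam / 4 * ‖W - R‖ ^ 2 + δ * (D + 1) := by
    intro s R W hs hR
    have h1 : inner ℝ s z - inner ℝ s W = -(inner ℝ s (W - R) + inner ℝ s (R - z)) := by
      rw [inner_sub_right, inner_sub_right]
      ring
    have h2 := (abs_le.1 (abs_real_inner_le_norm s (W - R))).1
    have h3 := (abs_le.1 (abs_real_inner_le_norm s (R - z))).1
    have h4 : ‖s‖ * ‖W - R‖ ≤ δ * ‖W - R‖ := mul_le_mul_of_nonneg_right hs.le (norm_nonneg _)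
    have h5 : ‖s‖ * ‖R - z‖ ≤ δ * D := mul_le_mul hs.le (hD R hR) (norm_nonneg _) hδ.le
    nlinarith [sq_nonneg (‖W - R‖ / 2 - δ), sq_nonneg ‖W - R‖]
  have h1 := hmax z hz z hz z z
  simp only [sub_self, norm_zero, map_zero, inner_zero_left] at h1
  have h2 := hlin p P X hp hP
  have h3 := hlin r Q Y hr hQ
  have h4 := hpos (X - Y)
  have h5 : 0 ≤ ε * ‖X - z‖ ^ 2 := by positivity
  nlinarith

end Penalization

section DoublingSequence

variable {n : ℕ}

/-- The linear map scaling time and space by the given factors. -/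
def stScale (lam N : ℝ) : Est n →L[ℝ] Est n :=
  ((WithLp.prodContinuousLinearEquiv 2 ℝ ℝ (En n)).symm : ℝ × En n →L[ℝ] Est n) ∘L
    ((lam • ContinuousLinearMap.id ℝ ℝ).prodMap (N • ContinuousLinearMap.id ℝ (En n))) ∘L
    (WithLp.prodContinuousLinearEquiv 2 ℝ ℝ (En n) : Est n →L[ℝ] ℝ × En n)

theorem stScale_fst (lam N : ℝ) (z : Est n) : (stScale lam N z).fst = lam * z.fst := rfl

theorem stScale_snd (lam N : ℝ) (z : Est n) : (stScale lam N z).snd = N • z.snd := rfl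

theorem norm_sq_est (z : Est n) : ‖z‖ ^ 2 = z.fst ^ 2 + ‖z.snd‖ ^ 2 := by
  rw [WithLp.prod_norm_sq_eq_of_L2, Real.norm_eq_abs, sq_abs]

theorem abs_fst_le_norm (z : Est n) : |z.fst| ≤ ‖z‖ := by
  refine abs_le_of_sq_le_sq ?_ (norm_nonneg _)
  rw [norm_sq_est]
  linarith [sq_nonneg ‖z.snd‖]

theorem norm_snd_le_norm (z : Est n) : ‖z.snd‖ ≤ ‖z‖ := by
  refine (abs_le_of_sq_le_sq ?_ (norm_nonneg _)).trans' (le_abs_self _)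
  rw [norm_sq_est]
  linarith [sq_nonneg z.fst]

theorem inner_stScale (lam N : ℝ) (z y : Est n) :
    inner ℝ (stScale lam N z) y = lam * (z.fst * y.fst) + N * inner ℝ z.snd y.snd := by
  rw [WithLp.prod_inner_apply]
  change inner ℝ (lam * z.fst) y.fst + inner ℝ (N • z.snd) y.snd = _
  rw [inner_smul_left]
  simp
  ring

theorem inner_stScale_self (lam N : ℝ) (z : Est n) :
    inner ℝ (stScale lam N z) z = lam * z.fst ^ 2 + N * ‖z.snd‖ ^ 2 := by
  rw [inner_stScale, real_inner_self_eq_norm_sq]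
  ring

theorem norm_stScale_le {lam N : ℝ} (hN : 0 ≤ N) (h : N ≤ lam) (z : Est n) :
    ‖stScale lam N z‖ ≤ lam * ‖z‖ := by
  have hlam := hN.trans h
  refine (abs_le_of_sq_le_sq ?_ (by positivity)).trans' (le_abs_self _)
  rw [mul_pow, norm_sq_est, norm_sq_est, stScale_fst, stScale_snd, norm_smul, Real.norm_eq_abs,
    abs_of_nonneg hN, mul_pow, mul_pow, mul_add]
  gcongr

theorem norm_stPoint_le (z : Est n) : ‖z‖ ≤ |z.fst| + ‖z.snd‖ := by
  refine (abs_le_of_sq_le_sq ?_ (by positivity)).trans' (le_abs_self _)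
  rw [norm_sq_est, ← sq_abs z.fst]
  nlinarith [mul_nonneg (abs_nonneg z.fst) (norm_nonneg z.snd)]

theorem exists_doubling_sequence {K : Set (Est n)} (hK : IsCompact K) {u w : Est n → ℝ}
    (hu : UpperSemicontinuousOn u K) (hw : UpperSemicontinuousOn w K) {z : Est n} (hz : z ∈ K)
    (huz : u z + w z = 0) (huw : ∀ P ∈ K, u P + w P ≤ 0) {ε : ℝ} (hε : 0 < ε) {ω : ℕ → ℝ}
    (hω : ∀ k, 0 < ω k) :
    ∃ (F : Filter ℕ) (P Q G₁ G₂ : ℕ → Est n) (A B : ℕ → Est n →L[ℝ] Est n), F.NeBot ∧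
      F ≤ atTop ∧ (∀ k, P k ∈ K) ∧ (∀ k, Q k ∈ K) ∧ Tendsto P F (𝓝 z) ∧ Tendsto Q F (𝓝 z) ∧
      Tendsto (fun k => u (P k)) F (𝓝 (u z)) ∧ Tendsto (fun k => w (Q k)) F (𝓝 (w z)) ∧
      Tendsto (fun k => G₁ k + G₂ k) F (𝓝 0) ∧ (∀ k, |(P k).fst - (Q k).fst| ≤ ω k) ∧
      Tendsto (fun k : ℕ => ‖(G₁ k).snd‖ * (‖(P k).snd - (Q k).snd‖ + 1 / (k + 1))) F (𝓝 0) ∧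
      Tendsto (fun k : ℕ => (k + 1) * (‖(P k).snd - (Q k).snd‖ + 1 / (k + 1)) ^ 2) F (𝓝 0) ∧
      (∀ k, ∀ η > 0, ∀ᶠ P' in 𝓝[K] P k, u P' ≤ u (P k) + inner ℝ (G₁ k) (P' - P k) +
        1 / 2 * inner ℝ (A k (P' - P k)) (P' - P k) + η * ‖P' - P k‖ ^ 2) ∧
      (∀ k, ∀ η > 0, ∀ᶠ Q' in 𝓝[K] Q k, w Q' ≤ w (Q k) + inner ℝ (G₂ k) (Q' - Q k) +
        1 / 2 * inner ℝ (B k (Q' - Q k)) (Q' - Q k) + η * ‖Q' - Q k‖ ^ 2) ∧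
      ∀ (k : ℕ) (c c' : En n), 1 / 2 * inner ℝ (A k (spaceDir c)) (spaceDir c) +
        1 / 2 * inner ℝ (B k (spaceDir c')) (spaceDir c') ≤
          (k + 1) / 2 * ‖c - c'‖ ^ 2 + ε * ‖c‖ ^ 2 := by
  obtain ⟨D, hD⟩ : ∃ D, ∀ P ∈ K, ‖P - z‖ ≤ D := by
    obtain ⟨R, hR⟩ := hK.isBounded.exists_norm_le
    exact ⟨R + ‖z‖, fun P hP => (norm_sub_le _ _).trans (by linarith [hR P hP])⟩
  have hD0 : 0 ≤ D := (norm_nonneg _).trans (hD z hz)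
  obtain ⟨M₁, hM₁⟩ := hu.bddAbove_of_isCompact hK
  obtain ⟨M₂, hM₂⟩ := hw.bddAbove_of_isCompact hK
  set C : ℝ := 2 * (M₁ + M₂) + 2 * (D + 1) with hC
  have hC0 : 0 ≤ C := by
    have h1 := hM₁ (mem_image_of_mem u hz)
    have h2 := hM₂ (mem_image_of_mem w hz)
    linarith
  let lam : ℕ → ℝ := fun k => (k + 1) + 18 * C / ω k ^ 2
  have hlamN : ∀ k : ℕ, (k + 1 : ℝ) ≤ lam k := fun k => by
    have : 0 ≤ 18 * C / ω k ^ 2 := by positivity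
    simp only [lam]
    linarith
  have hlamω : ∀ k, 18 * C ≤ lam k * ω k ^ 2 := fun k => by
    have h1 : 18 * C / ω k ^ 2 * ω k ^ 2 = 18 * C := div_mul_cancel₀ _ (pow_pos (hω k) 2).ne'
    have h2 : (0 : ℝ) ≤ (k + 1) * ω k ^ 2 := by positivity
    simp only [lam]
    linarith
  have hN1 : ∀ k : ℕ, (1 : ℝ) ≤ k + 1 := fun k => by linarith [Nat.cast_nonneg (α := ℝ) k]
  let δ : ℕ → ℝ := fun k => 1 / (k + 1) / 2
  have hδ : ∀ k, 0 < δ k := fun k => by positivity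
  have hδ' : ∀ k, δ k ≤ 1 / 2 := fun k => by
    have : (1 : ℝ) / (k + 1) ≤ 1 := div_le_one_of_le₀ (hN1 k) (by positivity)
    simp only [δ]
    linarith
  choose X Y P Q p r A B hP hQ hp hr hS hA hB hAB using fun k : ℕ =>
    exists_penalized_contact hK hu hw hz huz hD ((hN1 k).trans (hlamN k)) hε.le (hδ k) (hδ' k)
      (L := stScale (lam k) (k + 1))
      (fun x y => by rw [inner_stScale, inner_stScale, real_inner_comm, mul_comm x.fst])
      (fun x => by
        rw [inner_stScale_self]
        have := (zero_le_one.trans (hN1 k)).trans (hlamN k)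
        positivity)
      (norm_stScale_le (by positivity) (hlamN k))
  simp only [inner_stScale_self] at hS
  set S : ℕ → ℝ := fun k => lam k / 2 * ‖X k - P k‖ ^ 2 + lam k / 2 * ‖Y k - Q k‖ ^ 2 +
    1 / 2 * (lam k * (X k - Y k).fst ^ 2 + (k + 1) * ‖(X k - Y k).snd‖ ^ 2) +
      ε * ‖X k - z‖ ^ 2 with hSdef
  replace hS : ∀ k, S k ≤ 2 * (u (P k) + w (Q k)) + 4 * δ k * (D + 1) := hS
  have hSC : ∀ k, S k ≤ C := fun k => by
    have h1 := hM₁ (mem_image_of_mem u (hP k))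
    have h2 := hM₂ (mem_image_of_mem w (hQ k))
    have h3 : 4 * δ k * (D + 1) ≤ 2 * (D + 1) := by nlinarith [hδ' k]
    linarith [hS k]
  have hparts : ∀ k, 0 ≤ S k ∧ lam k * ‖X k - P k‖ ^ 2 ≤ 2 * S k ∧
      lam k * ‖Y k - Q k‖ ^ 2 ≤ 2 * S k ∧ lam k * (X k - Y k).fst ^ 2 ≤ 2 * S k ∧
      (k + 1) * ‖(X k - Y k).snd‖ ^ 2 ≤ 2 * S k ∧ ε * ‖X k - z‖ ^ 2 ≤ S k := by
    intro k
    have h0 := (zero_le_one.trans (hN1 k)).trans (hlamN k)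
    have h1 : 0 ≤ lam k * ‖X k - P k‖ ^ 2 := by positivity
    have h2 : 0 ≤ lam k * ‖Y k - Q k‖ ^ 2 := by positivity
    have h3 : 0 ≤ lam k * (X k - Y k).fst ^ 2 := by positivity
    have h4 : 0 ≤ (k + 1) * ‖(X k - Y k).snd‖ ^ 2 := by positivity
    have h5 : 0 ≤ ε * ‖X k - z‖ ^ 2 := by positivity
    simp only [hSdef]
    refine ⟨?_, ?_, ?_, ?_, ?_, ?_⟩ <;> linarith
  have hS0 : ∀ k, 0 ≤ S k := fun k => (hparts k).1
  let s : ℕ → ℝ := fun k => √(2 * S k)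
  have hs0 : ∀ k, 0 ≤ s k := fun k => Real.sqrt_nonneg _
  have hss : ∀ k, s k ^ 2 = 2 * S k := fun k => Real.sq_sqrt (by linarith [hS0 k])
  let m : ℕ → ℝ := fun k => √(k + 1)
  have hm0 : ∀ k, 0 < m k := fun k => Real.sqrt_pos.2 (by positivity)
  have hm1 : ∀ k, 1 ≤ m k := fun k => Real.one_le_sqrt.2 (hN1 k)
  have hmm : ∀ k : ℕ, m k ^ 2 = k + 1 := fun k => Real.sq_sqrt (by positivity)
  have hm : Tendsto (fun k => 1 / m k) atTop (𝓝 0) := by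
    simp only [one_div]
    refine tendsto_inv_atTop_zero.comp (Real.tendsto_sqrt_atTop.comp ?_)
    exact tendsto_atTop_add_const_right _ _ tendsto_natCast_atTop_atTop
  have hms : ∀ k (y : ℝ), 0 ≤ y → lam k * y ^ 2 ≤ 2 * S k → m k * y ≤ s k ∧ 3 * y ≤ ω k := by
    intro k y hy h
    refine ⟨(abs_le_of_sq_le_sq ?_ (hs0 k)).trans' (le_abs_self _), ?_⟩
    · rw [mul_pow, hmm, hss]
      nlinarith [hlamN k, sq_nonneg y]
    · have h0 := (zero_lt_one.trans_le (hN1 k)).trans_le (hlamN k)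
      refine (abs_le_of_sq_le_sq ?_ (hω k).le).trans' (le_abs_self _)
      refine le_of_mul_le_mul_left ?_ h0
      nlinarith [hlamω k, hSC k]
  have hXP : ∀ k, m k * ‖X k - P k‖ ≤ s k ∧ 3 * ‖X k - P k‖ ≤ ω k := fun k =>
    hms k _ (norm_nonneg _) (hparts k).2.1
  have hYQ : ∀ k, m k * ‖Y k - Q k‖ ≤ s k ∧ 3 * ‖Y k - Q k‖ ≤ ω k := fun k =>
    hms k _ (norm_nonneg _) (hparts k).2.2.1
  have hXY : ∀ k, m k * |(X k - Y k).fst| ≤ s k ∧ 3 * |(X k - Y k).fst| ≤ ω k := fun k =>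
    hms k _ (abs_nonneg _) (by
      rw [sq_abs]
      exact (hparts k).2.2.2.1)
  have hXY' : ∀ k, m k * ‖(X k - Y k).snd‖ ≤ s k := fun k => by
    refine (abs_le_of_sq_le_sq ?_ (hs0 k)).trans' (le_abs_self _)
    rw [mul_pow, hmm, hss]
    exact (hparts k).2.2.2.2.1
  have hPQ : ∀ k, P k - Q k = (X k - Y k) - (X k - P k) + (Y k - Q k) := fun k => by abel
  have hPQn : ∀ k, m k * ‖P k - Q k‖ ≤ 4 * s k := fun k => by
    have h1 : ‖P k - Q k‖ ≤ ‖X k - Y k‖ + ‖X k - P k‖ + ‖Y k - Q k‖ := by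
      rw [hPQ k]
      exact (norm_add_le _ _).trans (add_le_add (norm_sub_le _ _) le_rfl)
    have h2 := norm_stPoint_le (X k - Y k)
    nlinarith [hXP k, hYQ k, hXY k, hXY' k, hm0 k]
  have hPQs : ∀ k, m k * ‖(P k).snd - (Q k).snd‖ ≤ 3 * s k := fun k => by
    have h1 : (P k).snd - (Q k).snd = (X k - Y k).snd - (X k - P k).snd + (Y k - Q k).snd :=
      congrArg (fun z : Est n => z.snd) (hPQ k)
    have h2 := norm_add_le ((X k - Y k).snd - (X k - P k).snd) (Y k - Q k).snd
    have h3 := norm_sub_le (X k - Y k).snd (X k - P k).snd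
    rw [← h1] at h2
    nlinarith [hXP k, hYQ k, hXY' k, hm0 k, norm_snd_le_norm (X k - P k),
      norm_snd_le_norm (Y k - Q k)]
  have hPQt : ∀ k, |(P k).fst - (Q k).fst| ≤ ω k := fun k => by
    have h1 : (P k).fst - (Q k).fst = (X k - Y k).fst - (X k - P k).fst + (Y k - Q k).fst :=
      congrArg (fun z : Est n => z.fst) (hPQ k)
    have h2 := abs_add_le ((X k - Y k).fst - (X k - P k).fst) (Y k - Q k).fst
    have h3 := abs_sub (X k - Y k).fst (X k - P k).fst
    rw [← h1] at h2
    linarith [(hXP k).2, (hYQ k).2, (hXY k).2, abs_fst_le_norm (X k - P k),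
      abs_fst_le_norm (Y k - Q k)]
  let F : Ultrafilter ℕ := hyperfilter ℕ
  have hF : (F : Filter ℕ) ≤ atTop := Nat.hyperfilter_le_atTop
  have hmF : Tendsto (fun k => 1 / m k) F (𝓝 0) := hm.mono_left hF
  have hδF : Tendsto δ F (𝓝 0) := by
    have := (tendsto_one_div_add_atTop_nhds_zero_nat (𝕜 := ℝ)).div_const 2
    rw [zero_div] at this
    exact this.mono_left hF
  have hsmall : ∀ y : ℕ → Est n, (∀ k, m k * ‖y k‖ ≤ 4 * s k) → Tendsto y F (𝓝 0) := by
    intro y hy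
    refine squeeze_zero_norm (a := fun k => 4 * √(2 * C) * (1 / m k)) (fun k => ?_) ?_
    · have h1 : s k ≤ √(2 * C) := Real.sqrt_le_sqrt (by linarith [hSC k])
      rw [mul_one_div, le_div_iff₀ (hm0 k)]
      linarith [hy k, mul_comm ‖y k‖ (m k)]
    · simpa using hmF.const_mul (4 * √(2 * C))
  have hXP0 : Tendsto (fun k => X k - P k) F (𝓝 0) :=
    hsmall _ fun k => by linarith [(hXP k).1, hs0 k]
  have hPQ0 : Tendsto (fun k => P k - Q k) F (𝓝 0) := hsmall _ hPQn
  obtain ⟨z', hz'K, hPz'⟩ := hK.ultrafilter_le_nhds' (F.map P)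
    (Ultrafilter.mem_map.2 (univ_mem' hP))
  replace hPz' : Tendsto P F (𝓝 z') := hPz'
  have hQz' : Tendsto Q F (𝓝 z') := by simpa using hPz'.sub hPQ0
  have hup : ∀ e > 0, ∀ᶠ k in (F : Filter ℕ), u (P k) < u z' + e := fun e he =>
    (tendsto_nhdsWithin_iff.2 ⟨hPz', Eventually.of_forall hP⟩).eventually
      (hu z' hz'K _ (lt_add_of_pos_right _ he))
  have hwq : ∀ e > 0, ∀ᶠ k in (F : Filter ℕ), w (Q k) < w z' + e := fun e he =>
    (tendsto_nhdsWithin_iff.2 ⟨hQz', Eventually.of_forall hQ⟩).eventually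
      (hw z' hz'K _ (lt_add_of_pos_right _ he))
  have hδD : ∀ e > 0, ∀ᶠ k in (F : Filter ℕ), 4 * δ k * (D + 1) < e := fun e he => by
    have h : Tendsto (fun k => 4 * δ k * (D + 1)) F (𝓝 (4 * 0 * (D + 1))) :=
      (hδF.const_mul 4).mul_const _
    exact h.eventually (gt_mem_nhds (by simpa using he))
  have hSF : Tendsto S F (𝓝 0) := by
    refine tendsto_order.2 ⟨fun e he => Eventually.of_forall fun k => he.trans_le (hS0 k),
      fun e he => ?_⟩
    filter_upwards [hup (e / 8) (by positivity), hwq (e / 8) (by positivity),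
      hδD (e / 2) (by positivity)] with k h1 h2 h3
    linarith [hS k, huw z' hz'K]
  have hXz : Tendsto (fun k => ‖X k - z‖) F (𝓝 0) := by
    have h1 : Tendsto (fun k => √(S k / ε)) F (𝓝 0) := by
      have := (hSF.div_const ε).sqrt
      simpa using this
    refine squeeze_zero (fun k => norm_nonneg _) (fun k => Real.le_sqrt_of_sq_le ?_) h1
    rw [le_div_iff₀ hε, mul_comm]
    exact (hparts k).2.2.2.2.2
  have hz'z : z' = z := by
    have h1 : Tendsto (fun k => (X k - z) - (X k - P k) + z) F (𝓝 (0 - 0 + z)) :=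
      ((tendsto_zero_iff_norm_tendsto_zero.2 hXz).sub hXP0).add_const z
    refine tendsto_nhds_unique hPz' ?_
    simpa using h1
  subst hz'z
  have hsF : Tendsto s F (𝓝 0) := by
    have : Tendsto s F (𝓝 √(2 * 0)) := (hSF.const_mul 2).sqrt
    rwa [mul_zero, Real.sqrt_zero] at this
  let β : ℕ → ℝ := fun k => s k + 2 * ε * ‖X k - z'‖ + 2 * δ k + 1 / m k
  have hβ : Tendsto β F (𝓝 0) := by
    have : Tendsto β F (𝓝 (0 + 2 * ε * 0 + 2 * 0 + 0)) :=
      ((hsF.add (hXz.const_mul (2 * ε))).add (hδF.const_mul 2)).add hmF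
    simpa only [mul_zero, add_zero] using this
  have hme : ∀ k : ℕ, m k * (‖(P k).snd - (Q k).snd‖ + 1 / (k + 1)) ≤ 3 * β k := fun k => by
    have h1 : m k * (1 / (k + 1)) = 1 / m k := by
      rw [← hmm k]
      field_simp
    have h2 : 0 ≤ ε * ‖X k - z'‖ := by positivity
    have h3 : 0 < 1 / m k := one_div_pos.2 (hm0 k)
    rw [mul_add, h1]
    simp only [β]
    linarith [hPQs k, hδ k]
  refine ⟨F, P, Q, fun k => stScale (lam k) (k + 1) (X k - Y k) + (2 * ε) • (X k - z') + p k,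
    fun k => -stScale (lam k) (k + 1) (X k - Y k) + r k, A, B, inferInstance, hF, hP, hQ, hPz',
    hQz', ?_, ?_, ?_, hPQt, ?_, ?_, hA, hB, fun k c c' => ?_⟩
  · refine tendsto_order.2 ⟨fun y hy => ?_, fun y hy => ?_⟩
    · filter_upwards [hwq ((u z' - y) / 2) (by linarith), hδD (u z' - y) (by linarith)] with k h1 h2
      linarith [hS k, hS0 k]
    · filter_upwards [hup (y - u z') (by linarith)] with k h1
      linarith
  · refine tendsto_order.2 ⟨fun y hy => ?_, fun y hy => ?_⟩
    · filter_upwards [hup ((w z' - y) / 2) (by linarith), hδD (w z' - y) (by linarith)] with k h1 h2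
      linarith [hS k, hS0 k]
    · filter_upwards [hwq (y - w z') (by linarith)] with k h1
      linarith
  · refine squeeze_zero_norm (fun k => ?_) hβ
    have h1 : stScale (lam k) (k + 1) (X k - Y k) + (2 * ε) • (X k - z') + p k +
        (-stScale (lam k) (k + 1) (X k - Y k) + r k) = (2 * ε) • (X k - z') + p k + r k := by
      abel
    rw [h1]
    have h2 := norm_add₃_le (a := (2 * ε) • (X k - z')) (b := p k) (c := r k)
    rw [norm_smul, Real.norm_eq_abs, abs_of_pos (by positivity)] at h2
    have h3 : 0 < 1 / m k := one_div_pos.2 (hm0 k)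
    simp only [β]
    linarith [hp k, hr k, hs0 k]
  · have hlim : Tendsto (fun k => β k * (3 * β k)) F (𝓝 0) := by
      simpa using hβ.mul (hβ.const_mul 3)
    refine squeeze_zero (fun k => by positivity) (fun k => ?_) hlim
    have h1 : ‖(stScale (lam k) (k + 1) (X k - Y k) + (2 * ε) • (X k - z') + p k).snd‖ ≤
        m k * β k := by
      have h2 := norm_add₃_le (a := ((k : ℝ) + 1) • (X k - Y k).snd)
        (b := ((2 * ε) • (X k - z')).snd) (c := (p k).snd)
      have h3 := norm_snd_le_norm ((2 * ε) • (X k - z'))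
      have h4 := norm_snd_le_norm (p k)
      rw [norm_smul, Real.norm_eq_abs, abs_of_pos (by positivity)] at h2 h3
      have h5 : 0 < 1 / m k := one_div_pos.2 (hm0 k)
      have h6 : 0 ≤ 2 * ε * ‖X k - z'‖ := by positivity
      have h7 : ((k : ℝ) + 1) * ‖(X k - Y k).snd‖ ≤ m k * s k := by
        rw [← hmm k, sq, mul_assoc]
        exact mul_le_mul_of_nonneg_left (hXY' k) (hm0 k).le
      refine h2.trans ?_
      simp only [β]
      nlinarith [hp k, hδ k, hm1 k]
    refine (mul_le_mul_of_nonneg_right h1 (by positivity)).trans ?_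
    have h2 : 0 ≤ β k := by
      have := (norm_nonneg _).trans h1
      exact nonneg_of_mul_nonneg_right this (hm0 k)
    nlinarith [mul_le_mul_of_nonneg_left (hme k) h2]
  · have hlim : Tendsto (fun k => (3 * β k) ^ 2) F (𝓝 0) := by
      simpa using (hβ.const_mul 3).pow 2
    refine squeeze_zero (fun k => by positivity) (fun k => ?_) hlim
    rw [← hmm k, ← mul_pow]
    refine pow_le_pow_left₀ ?_ ?_ 2
    · have := (hm0 k).le
      positivity
    · rw [hmm k]
      exact hme k
  · have h1 := hAB k (spaceDir c) (spaceDir c')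
    rw [← map_sub, inner_stScale_self, norm_spaceDir, spaceDir_fst, spaceDir_snd] at h1
    linarith

end DoublingSequence

section Coefficients

variable {n d : ℕ} {T : ℝ}

theorem frob_zero : frob (0 : Matrix (Fin n) (Fin d) ℝ) = 0 := by simp [frob]

theorem frob_eq_norm (M : Matrix (Fin n) (Fin d) ℝ) :
    frob M = ‖(WithLp.toLp 2 fun p => M p.1 p.2 : EuclideanSpace ℝ (Fin n × Fin d))‖ := by
  rw [frob, EuclideanSpace.norm_eq, Fintype.sum_prod_type]
  simp

theorem frob_add_le (M N : Matrix (Fin n) (Fin d) ℝ) : frob (M + N) ≤ frob M + frob N := by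
  simp only [frob_eq_norm]
  exact norm_add_le (WithLp.toLp 2 fun p => M p.1 p.2 : EuclideanSpace ℝ (Fin n × Fin d))
    (WithLp.toLp 2 fun p => N p.1 p.2)

variable {a : ℝ → En n → En n} {σm : ℝ → En n → Matrix (Fin n) (Fin d) ℝ}

theorem exists_time_modulus (hac : ContinuousOn (fun p : ℝ × En n => a p.1 p.2) (Strip n T))
    (hσc : ContinuousOn (fun p : ℝ × En n => σm p.1 p.2) (Strip n T)) (z : En n) {e : ℝ}
    (he : 0 < e) :
    ∃ ω > 0, ∀ t ∈ Icc 0 T, ∀ s ∈ Icc 0 T, |t - s| ≤ ω → ∀ x, ‖x - z‖ ≤ 1 →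
      ‖a t x - a s x‖ + frob (σm t x - σm s x) ≤ e := by
  set S : Set (ℝ × ℝ × En n) := Icc 0 T ×ˢ Icc 0 T ×ˢ Metric.closedBall z 1 with hS
  have hSc : IsCompact S := isCompact_Icc.prod (isCompact_Icc.prod (isCompact_closedBall z 1))
  let h : ℝ × ℝ × En n → ℝ := fun p =>
    ‖a p.1 p.2.2 - a p.2.1 p.2.2‖ + frob (σm p.1 p.2.2 - σm p.2.1 p.2.2)
  have hc₁ : ContinuousOn (fun p : ℝ × ℝ × En n => (p.1, p.2.2)) S := by fun_prop
  have hc₂ : ContinuousOn (fun p : ℝ × ℝ × En n => (p.2.1, p.2.2)) S := by fun_prop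
  have hm₁ : MapsTo (fun p : ℝ × ℝ × En n => (p.1, p.2.2)) S (Strip n T) :=
    fun p hp => ⟨hp.1, mem_univ _⟩
  have hm₂ : MapsTo (fun p : ℝ × ℝ × En n => (p.2.1, p.2.2)) S (Strip n T) :=
    fun p hp => ⟨hp.2.1, mem_univ _⟩
  have hh : ContinuousOn h S :=
    ((hac.comp hc₁ hm₁).sub (hac.comp hc₂ hm₂)).norm.add
      (continuous_frob.comp_continuousOn ((hσc.comp hc₁ hm₁).sub (hσc.comp hc₂ hm₂)))
  have hB : IsCompact (S ∩ h ⁻¹' Ici e) :=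
    hSc.of_isClosed_subset (hh.preimage_isClosed_of_isClosed hSc.isClosed isClosed_Ici)
      inter_subset_left
  rcases (S ∩ h ⁻¹' Ici e).eq_empty_or_nonempty with hemp | hne
  · refine ⟨1, one_pos, fun t ht s hs _ x hx => ?_⟩
    by_contra! hlt
    have : (t, s, x) ∈ S ∩ h ⁻¹' Ici e :=
      ⟨⟨ht, hs, mem_closedBall_iff_norm.2 hx⟩, mem_preimage.2 (mem_Ici.2 hlt.le)⟩
    rwa [hemp] at this
  · have hcont : ContinuousOn (fun p : ℝ × ℝ × En n => |p.1 - p.2.1|) (S ∩ h ⁻¹' Ici e) := by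
      fun_prop
    obtain ⟨p, hp, hmin⟩ := hB.exists_isMinOn hne hcont
    have hp0 : 0 < |p.1 - p.2.1| := by
      refine abs_pos.2 (sub_ne_zero.2 fun heq => ?_)
      have h1 : e ≤ h p := hp.2
      simp only [h, heq, sub_self, norm_zero, frob_zero, add_zero] at h1
      linarith
    refine ⟨|p.1 - p.2.1| / 2, by positivity, fun t ht s hs hts x hx => ?_⟩
    by_contra! hlt
    have h1 : |p.1 - p.2.1| ≤ |t - s| :=
      hmin (show (t, s, x) ∈ S ∩ h ⁻¹' Ici e from
        ⟨⟨ht, hs, mem_closedBall_iff_norm.2 hx⟩, mem_preimage.2 (mem_Ici.2 hlt.le)⟩)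
    linarith

theorem coeff_sub_le {k e : ℝ} {t s : ℝ} {x y : En n}
    (hLip : ‖a s x - a s y‖ + frob (σm s x - σm s y) ≤ k * ‖x - y‖)
    (hts : ‖a t x - a s x‖ + frob (σm t x - σm s x) ≤ e) :
    ‖a t x - a s y‖ + frob (σm t x - σm s y) ≤ k * ‖x - y‖ + e := by
  have h1 := norm_add_le (a t x - a s x) (a s x - a s y)
  have h2 := frob_add_le (σm t x - σm s x) (σm s x - σm s y)
  rw [sub_add_sub_cancel] at h1 h2
  linarith

end Coefficients

section Touching

variable {n d : ℕ} {T : ℝ}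

/-- The points of Euclidean space-time in the time interval `[0, T]` whose space component
is at distance at most one from `z`. -/
def cylinder (T : ℝ) (z : En n) : Set (Est n) := {P | P.fst ∈ Icc 0 T ∧ ‖P.snd - z‖ ≤ 1}

theorem continuous_est_prod : Continuous fun P : Est n => (P.fst, P.snd) :=
  (WithLp.prodContinuousLinearEquiv 2 ℝ ℝ (En n)).continuous

theorem isCompact_cylinder (T : ℝ) (z : En n) : IsCompact (cylinder T z) := by
  have h := (isCompact_Icc (a := 0) (b := T)).prod (isCompact_closedBall z 1)
  convert h.image (WithLp.prodContinuousLinearEquiv 2 ℝ ℝ (En n)).symm.continuous using 1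
  ext P
  constructor
  · intro hP
    exact ⟨(P.fst, P.snd), ⟨hP.1, mem_closedBall_iff_norm.2 hP.2⟩, rfl⟩
  · rintro ⟨p, hp, rfl⟩
    exact ⟨hp.1, mem_closedBall_iff_norm.1 hp.2⟩

theorem tendsto_stPoint_cylinder {z : En n} {P : Est n} (hP : ‖P.snd - z‖ < 1) :
    Tendsto (fun p : ℝ × En n => stPoint p.1 p.2) (𝓝[Strip n T] (P.fst, P.snd))
      (𝓝[cylinder T z] P) := by
  have hc : Continuous fun p : ℝ × En n => stPoint p.1 p.2 := (contDiff_stPoint (k := 0)).continuous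
  refine tendsto_nhdsWithin_iff.2 ⟨(hc.tendsto (P.fst, P.snd)).mono_left nhdsWithin_le_nhds, ?_⟩
  have hc' : Continuous fun p : ℝ × En n => ‖p.2 - z‖ := by fun_prop
  filter_upwards [self_mem_nhdsWithin, eventually_nhdsWithin_of_eventually_nhds
    ((hc'.tendsto (P.fst, P.snd)).eventually (gt_mem_nhds hP))] with p h1 h2
  exact ⟨h1.1, h2.le⟩

theorem quadFn_add_smul_id (c : ℝ) (G P : Est n) (A : Est n →L[ℝ] Est n) (η t : ℝ) (x : En n) :
    quadFn c G P (A + (2 * η) • ContinuousLinearMap.id ℝ _) t x = c + inner ℝ G (stPoint t x - P) +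
      1 / 2 * inner ℝ (A (stPoint t x - P)) (stPoint t x - P) + η * ‖stPoint t x - P‖ ^ 2 := by
  rw [quadFn, _root_.add_apply, _root_.smul_apply, inner_add_left, inner_smul_left,
    ContinuousLinearMap.id_apply, real_inner_self_eq_norm_sq]
  simp only [RCLike.conj_to_real]
  ring

/-- The differential operator `∂_t + L` evaluated on a second-order expansion at `P` with
gradient `G` and Hessian `A`. -/
def jetOp (a : ℝ → En n → En n) (σm : ℝ → En n → Matrix (Fin n) (Fin d) ℝ) (P G : Est n)
    (A : Est n →L[ℝ] Est n) : ℝ :=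
  G.fst + inner ℝ (a P.fst P.snd) G.snd + 1 / 2 * ∑ k, inner ℝ
    (A (spaceDir (colVec (σm P.fst P.snd) k))) (spaceDir (colVec (σm P.fst P.snd) k))

theorem jetOp_add_smul_id (a : ℝ → En n → En n) (σm : ℝ → En n → Matrix (Fin n) (Fin d) ℝ)
    (P G : Est n) (A : Est n →L[ℝ] Est n) (η : ℝ) :
    jetOp a σm P G (A + (2 * η) • ContinuousLinearMap.id ℝ _) =
      jetOp a σm P G A + η * frob (σm P.fst P.snd) ^ 2 := by
  have h : ∀ c : En n, inner ℝ ((A + (2 * η) • ContinuousLinearMap.id ℝ (Est n)) (spaceDir c))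
      (spaceDir c) = inner ℝ (A (spaceDir c)) (spaceDir c) + 2 * η * ‖c‖ ^ 2 := by
    intro c
    rw [_root_.add_apply, _root_.smul_apply, inner_add_left, inner_smul_left,
      ContinuousLinearMap.id_apply, real_inner_self_eq_norm_sq, norm_spaceDir]
    simp only [RCLike.conj_to_real]
  simp only [jetOp, h, Finset.sum_add_distrib, ← Finset.mul_sum, ← frob_sq]
  ring

theorem ptd_add_genL_quadFn (a : ℝ → En n → En n) (σm : ℝ → En n → Matrix (Fin n) (Fin d) ℝ)
    (c : ℝ) (G P : Est n) (A : Est n →L[ℝ] Est n) :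
    ptd (quadFn c G P A) P.fst P.snd + genL a σm (quadFn c G P A) P.fst P.snd =
      jetOp a σm P G A := by
  rw [ptd_quadFn, genL_quadFn, jetOp]
  ring

theorem nonneg_of_forall_pos_le_mul {x c : ℝ} (h : ∀ η > 0, 0 ≤ x + η * c ^ 2) : 0 ≤ x := by
  refine le_of_forall_pos_le_add fun e he => ?_
  refine (h (e / (c ^ 2 + 1)) (by positivity)).trans (add_le_add le_rfl ?_)
  rw [div_mul_eq_mul_div, div_le_iff₀ (by positivity)]
  nlinarith

variable {U : Type} [Nonempty U] {Γ : ℝ → En n → U → En n} {ℓ : ℝ → En n → U → ℝ}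
  {a : ℝ → En n → En n} {σm : ℝ → En n → Matrix (Fin n) (Fin d) ℝ}
  {f : ℝ → En n → ℝ → Ed d → ℝ} {ψ : En n → ℝ} {z : En n}

theorem IsSub.jet_le {u : ℝ → En n → ℝ} (hu : IsSub T Γ ℓ a σm f ψ u) {P G : Est n}
    {A : Est n →L[ℝ] Est n} (hP : P.fst ∈ Ico 0 T) (hPz : ‖P.snd - z‖ < 1)
    (hM : Mop Γ ℓ u P.fst P.snd < u P.fst P.snd)
    (hjet : ∀ η > 0, ∀ᶠ P' in 𝓝[cylinder T z] P, u P'.fst P'.snd ≤ u P.fst P.snd +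
      inner ℝ G (P' - P) + 1 / 2 * inner ℝ (A (P' - P)) (P' - P) + η * ‖P' - P‖ ^ 2) :
    0 ≤ jetOp a σm P G A + f P.fst P.snd (u P.fst P.snd)
      (transMulVec (σm P.fst P.snd) G.snd) := by
  refine nonneg_of_forall_pos_le_mul (c := frob (σm P.fst P.snd)) fun η hη => ?_
  set A' := A + (2 * η) • ContinuousLinearMap.id ℝ (Est n) with hA'
  have hmin : IsLocalMinOn (fun p : ℝ × En n =>
      quadFn (u P.fst P.snd) G P A' p.1 p.2 - u p.1 p.2) (Strip n T) (P.fst, P.snd) := by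
    filter_upwards [(tendsto_stPoint_cylinder hPz).eventually (hjet η hη)] with p hp
    rw [stPoint_fst, stPoint_snd] at hp
    rw [quadFn_self, sub_self, hA', quadFn_add_smul_id]
    linarith
  have h := hu.2.2 P.fst hP P.snd _ (isTest_quadFn _ G P A') (quadFn_self _ _ _ _) hmin
  rcases min_le_iff.1 h with h | h
  · linarith
  · have h1 := ptd_add_genL_quadFn a σm (u P.fst P.snd) G P A'
    have h2 := jetOp_add_smul_id a σm P G A η
    rw [sigGrad_quadFn] at h
    linarith

theorem IsSuper.jet_le {v g : ℝ → En n → ℝ} (hv : IsSuper T Γ ℓ a σm f ψ v) (hg : IsTest g)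
    (θ : ℝ) {Q G : Est n} {B : Est n →L[ℝ] Est n} (hQ : Q.fst ∈ Ico 0 T) (hQz : ‖Q.snd - z‖ < 1)
    (hjet : ∀ η > 0, ∀ᶠ Q' in 𝓝[cylinder T z] Q, -(v Q'.fst Q'.snd + θ * g Q'.fst Q'.snd) ≤
      -(v Q.fst Q.snd + θ * g Q.fst Q.snd) + inner ℝ G (Q' - Q) +
        1 / 2 * inner ℝ (B (Q' - Q)) (Q' - Q) + η * ‖Q' - Q‖ ^ 2) :
    0 ≤ jetOp a σm Q G B + θ * (ptd g Q.fst Q.snd + genL a σm g Q.fst Q.snd) -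
      f Q.fst Q.snd (v Q.fst Q.snd) (-transMulVec (σm Q.fst Q.snd) G.snd -
        θ • sigGrad σm g Q.fst Q.snd) := by
  refine nonneg_of_forall_pos_le_mul (c := frob (σm Q.fst Q.snd)) fun η hη => ?_
  set B' := B + (2 * η) • ContinuousLinearMap.id ℝ (Est n) with hB'
  set c := v Q.fst Q.snd + θ * g Q.fst Q.snd with hc
  have hneg : ∀ t x, quadFn c (-G) Q (-B') t x = -quadFn (-c) G Q B' t x := by
    intro t x
    rw [quadFn, quadFn, inner_neg_left, _root_.neg_apply, inner_neg_left]
    ring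
  have hmax : IsLocalMaxOn (fun p : ℝ × En n =>
      quadFn c (-G) Q (-B') p.1 p.2 - θ * g p.1 p.2 - v p.1 p.2) (Strip n T) (Q.fst, Q.snd) := by
    filter_upwards [(tendsto_stPoint_cylinder hQz).eventually (hjet η hη)] with p hp
    rw [stPoint_fst, stPoint_snd] at hp
    rw [quadFn_self, hneg, hB', quadFn_add_smul_id]
    linarith
  have hq := isTest_quadFn c (-G) Q (-B')
  have h := hv.2.2 Q.fst hQ Q.snd _ (hq.sub_smul hg θ) (by
    rw [quadFn_self]
    linarith) hmax
  have h0 := (le_min_iff.1 h).2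
  have h1 := ptd_add_genL_quadFn a σm c (-G) Q (-B')
  have h2 := jetOp_add_smul_id a σm Q G B η
  have h3 : jetOp a σm Q (-G) (-B') = -jetOp a σm Q G B' := by
    simp only [jetOp, WithLp.neg_fst, WithLp.neg_snd, _root_.neg_apply, inner_neg_left,
      inner_neg_right, Finset.sum_neg_distrib]
    ring
  rw [ptd_sub_smul hq hg, genL_sub_smul a σm hq hg, sigGrad_sub_smul σm hq hg, sigGrad_quadFn,
    WithLp.neg_snd, transMulVec_neg_right] at h0
  linarith

end Touching

section Comparison

variable {n d : ℕ} {T : ℝ}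

theorem jetOp_add_le {a : ℝ → En n → En n} {σm : ℝ → En n → Matrix (Fin n) (Fin d) ℝ}
    {P Q G H : Est n} {A B : Est n →L[ℝ] Est n} {N ε e : ℝ} (hN : 0 ≤ N)
    (he : ‖a P.fst P.snd - a Q.fst Q.snd‖ +
      frob (σm P.fst P.snd - σm Q.fst Q.snd) ≤ e)
    (hAB : ∀ c c' : En n, 1 / 2 * inner ℝ (A (spaceDir c)) (spaceDir c) +
      1 / 2 * inner ℝ (B (spaceDir c')) (spaceDir c') ≤ N / 2 * ‖c - c'‖ ^ 2 + ε * ‖c‖ ^ 2) :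
    jetOp a σm P G A + jetOp a σm Q H B ≤ (1 + ‖a Q.fst Q.snd‖) * ‖G + H‖ + e * ‖G.snd‖ +
      N / 2 * e ^ 2 + ε * frob (σm P.fst P.snd) ^ 2 := by
  have h1 : G.fst + H.fst ≤ ‖G + H‖ := (le_abs_self _).trans (abs_fst_le_norm (G + H))
  have h2 : inner ℝ (a P.fst P.snd) G.snd + inner ℝ (a Q.fst Q.snd) H.snd ≤
      e * ‖G.snd‖ + ‖a Q.fst Q.snd‖ * ‖G + H‖ := by
    have h3 : inner ℝ (a P.fst P.snd) G.snd + inner ℝ (a Q.fst Q.snd) H.snd =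
        inner ℝ (a P.fst P.snd - a Q.fst Q.snd) G.snd +
          inner ℝ (a Q.fst Q.snd) (G + H).snd := by
      rw [inner_sub_left, WithLp.add_snd, inner_add_right]
      ring
    rw [h3]
    refine add_le_add ((real_inner_le_norm _ _).trans ?_) ((real_inner_le_norm _ _).trans ?_)
    · gcongr
      linarith [frob_nonneg (σm P.fst P.snd - σm Q.fst Q.snd)]
    · gcongr
      exact norm_snd_le_norm _
  have h4 := Finset.sum_le_sum fun (k : Fin d) (_ : k ∈ Finset.univ) =>
    hAB (colVec (σm P.fst P.snd) k) (colVec (σm Q.fst Q.snd) k)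
  simp only [← colVec_sub, Finset.sum_add_distrib, ← Finset.mul_sum, ← frob_sq] at h4
  have h5 : frob (σm P.fst P.snd - σm Q.fst Q.snd) ^ 2 ≤ e ^ 2 :=
    pow_le_pow_left₀ (frob_nonneg _)
      (by linarith [norm_nonneg (a P.fst P.snd - a Q.fst Q.snd)]) 2
  have h6 := mul_le_mul_of_nonneg_left h5 (by positivity : 0 ≤ N / 2)
  simp only [jetOp]
  linarith

theorem norm_transMulVec_sub_le (M N : Matrix (Fin n) (Fin d) ℝ) (p q : En n) (s : Ed d) :
    ‖transMulVec M p - (-transMulVec N q - s)‖ ≤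
      frob (M - N) * ‖p‖ + frob N * ‖p + q‖ + ‖s‖ := by
  have h : transMulVec M p - (-transMulVec N q - s) =
      transMulVec (M - N) p + transMulVec N (p + q) + s := by
    rw [transMulVec_sub, transMulVec_add_right]
    abel
  rw [h]
  exact (norm_add₃_le).trans (add_le_add (add_le_add (norm_transMulVec_le _ _)
    (norm_transMulVec_le _ _)) le_rfl)


theorem not_contact_of_mop_lt {U : Type} [TopologicalSpace U] [CompactSpace U] [Nonempty U]
    {Γ : ℝ → En n → U → En n} {ℓ : ℝ → En n → U → ℝ} {a : ℝ → En n → En n}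
    {σm : ℝ → En n → Matrix (Fin n) (Fin d) ℝ} {f : ℝ → En n → ℝ → Ed d → ℝ} {ψ : En n → ℝ}
    {kf κ : ℝ} (hkf : 0 ≤ kf) (hκ : 0 ≤ κ)
    (hΓc : ContinuousOn (fun p : ℝ × En n × U => Γ p.1 p.2.1 p.2.2)
      (Icc 0 T ×ˢ (univ : Set (En n × U))))
    (hℓc : ContinuousOn (fun p : ℝ × En n × U => ℓ p.1 p.2.1 p.2.2)
      (Icc 0 T ×ˢ (univ : Set (En n × U))))
    (hac : ContinuousOn (fun p : ℝ × En n => a p.1 p.2) (Strip n T))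
    (hσc : ContinuousOn (fun p : ℝ × En n => σm p.1 p.2) (Strip n T))
    (haσLip : ∀ t ∈ Icc (0:ℝ) T, ∀ x x' : En n,
      ‖a t x - a t x'‖ + frob (σm t x - σm t x') ≤ κ * ‖x - x'‖)
    (hfc : ∀ ε > (0:ℝ), ∀ p ∈ Strip n T, ∃ δ' > (0:ℝ),
      ∀ q ∈ Strip n T, dist q p ≤ δ' → ∀ (y : ℝ) (z : Ed d),
        |f q.1 q.2 y z - f p.1 p.2 y z| ≤ ε)
    (hfLip : ∀ t ∈ Icc (0:ℝ) T, ∀ (x : En n) (y y' : ℝ) (z z' : Ed d),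
      |f t x y' z' - f t x y z| ≤ kf * (|y' - y| + ‖z' - z‖))
    {u v g : ℝ → En n → ℝ} (hv : IsSuper T Γ ℓ a σm f ψ v) (hu : IsSub T Γ ℓ a σm f ψ u)
    (hg : IsTest g) (hg0 : ∀ t x, 0 < g t x) {C₁ : ℝ}
    (hgb : ∀ t ∈ Icc (0:ℝ) T, ∀ x, genL a σm g t x ≤ C₁ * g t x ∧
      ‖sigGrad σm g t x‖ ≤ C₁ * g t x ∧ ptd g t x = -((C₁ + kf + kf * C₁ + 1) * g t x))
    {θ : ℝ} (hθ : 0 < θ) (hle : ∀ p ∈ Strip n T, u p.1 p.2 - v p.1 p.2 ≤ θ * g p.1 p.2)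
    {t : ℝ} (ht : t ∈ Ico 0 T) {x : En n} (heq : u t x - v t x = θ * g t x) :
    ¬ ∀ b, u t (Γ t x b) - ℓ t x b < u t x := by
  intro hM
  have hp : (t, x) ∈ Strip n T := ⟨Ico_subset_Icc_self ht, mem_univ _⟩
  obtain ⟨c, hc, hMc⟩ := eventually_mop_le hu.1 hΓc hℓc hp hM
  have hγ : 0 < θ * g t x := mul_pos hθ (hg0 t x)
  obtain ⟨δ', hδ', hfδ⟩ := hfc (θ * g t x / 8) (by positivity) (t, x) hp
  choose ω hω hωb using fun k : ℕ => exists_time_modulus hac hσc x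
    (show (0 : ℝ) < 1 / (k + 1) by positivity)
  have hgc : Continuous fun p : ℝ × En n => g p.1 p.2 := hg.continuous
  have hmaps : MapsTo (fun P : Est n => (P.fst, P.snd)) (cylinder T x) (Strip n T) :=
    fun P hP => ⟨hP.1, mem_univ _⟩
  have husc : UpperSemicontinuousOn (fun P : Est n => u P.fst P.snd) (cylinder T x) :=
    UpperSemicontinuousOn.comp (f := fun p : ℝ × En n => u p.1 p.2) hu.1
      continuous_est_prod.continuousOn hmaps
  have hwsc : UpperSemicontinuousOn (fun P : Est n => -(v P.fst P.snd + θ * g P.fst P.snd))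
      (cylinder T x) := by
    have h1 : LowerSemicontinuousOn (fun p : ℝ × En n => v p.1 p.2 + θ * g p.1 p.2)
        (Strip n T) := hv.1.add (hgc.const_mul θ).continuousOn.lowerSemicontinuousOn
    exact UpperSemicontinuousOn.comp (f := fun p : ℝ × En n => -(v p.1 p.2 + θ * g p.1 p.2))
      h1.neg continuous_est_prod.continuousOn hmaps
  have hz : stPoint t x ∈ cylinder T x := ⟨hp.1, by simp [stPoint_snd]⟩
  set ε := θ * g t x / (4 * (frob (σm t x) ^ 2 + 1)) with hε
  obtain ⟨F, P, Q, G, H, A, B, hF, -, hPK, hQK, hPz, hQz, huP, hwQ, hGH, htime, hX₁, hX₂,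
    hjP, hjQ, hAB⟩ := exists_doubling_sequence (isCompact_cylinder T x) husc hwsc hz
      (by
        rw [stPoint_fst, stPoint_snd]
        linarith)
      (fun P hP => by
        have := hle _ (hmaps hP)
        dsimp only at this
        linarith) (ε := ε) (by positivity) hω
  have hP' : Tendsto (fun k => ((P k).fst, (P k).snd)) F (𝓝[Strip n T] (t, x)) :=
    tendsto_nhdsWithin_iff.2 ⟨(continuous_est_prod.tendsto (stPoint t x)).comp hPz,
      Eventually.of_forall fun k => hmaps (hPK k)⟩
  have hQ' : Tendsto (fun k => ((Q k).fst, (Q k).snd)) F (𝓝[Strip n T] (t, x)) :=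
    tendsto_nhdsWithin_iff.2 ⟨(continuous_est_prod.tendsto (stPoint t x)).comp hQz,
      Eventually.of_forall fun k => hmaps (hQK k)⟩
  have hgQ : Tendsto (fun k => g (Q k).fst (Q k).snd) F (𝓝 (g t x)) :=
    (hgc.tendsto (t, x)).comp (hQ'.mono_right nhdsWithin_le_nhds)
  have haQ : Tendsto (fun k => a (Q k).fst (Q k).snd) F (𝓝 (a t x)) :=
    Tendsto.comp (hac (t, x) hp) hQ'
  have hσQ : Tendsto (fun k => frob (σm (Q k).fst (Q k).snd)) F (𝓝 (frob (σm t x))) :=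
    (continuous_frob.tendsto _).comp (Tendsto.comp (hσc (t, x) hp) hQ')
  have hσP : Tendsto (fun k => frob (σm (P k).fst (P k).snd)) F (𝓝 (frob (σm t x))) :=
    (continuous_frob.tendsto _).comp (Tendsto.comp (hσc (t, x) hp) hP')
  have hS : Tendsto (fun k => ‖G k + H k‖) F (𝓝 0) := by simpa using hGH.norm
  have huv : Tendsto (fun k => |u (P k).fst (P k).snd - v (Q k).fst (Q k).snd|) F
      (𝓝 (θ * g t x)) := by
    have h1 := ((huP.add hwQ).add (hgQ.const_mul θ)).abs
    rw [stPoint_fst, stPoint_snd] at h1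
    convert h1 using 2
    · congr 1
      ring
    · rw [← abs_of_pos hγ]
      congr 1
      linarith
  have hnear : ∀ᶠ q in 𝓝[Strip n T] (t, x), q.1 ∈ Ico 0 T ∧ ‖q.2 - x‖ < 1 ∧
      Mop Γ ℓ u q.1 q.2 ≤ c ∧
      ∀ (y : ℝ) (z : Ed d), |f q.1 q.2 y z - f t x y z| ≤ θ * g t x / 8 := by
    filter_upwards [self_mem_nhdsWithin, hMc, mem_nhdsWithin_of_mem_nhds
      (Metric.closedBall_mem_nhds (t, x) hδ'), mem_nhdsWithin_of_mem_nhds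
      (Metric.ball_mem_nhds (t, x) (lt_min one_pos (sub_pos.2 ht.2)))] with q hq h1 h2 h3
    rw [Metric.mem_ball, Prod.dist_eq, max_lt_iff, lt_min_iff, lt_min_iff, Real.dist_eq,
      dist_eq_norm] at h3
    exact ⟨⟨hq.1.1, by linarith [(abs_lt.1 h3.1.2).2]⟩, h3.2.1, h1, fun y z => hfδ q hq h2 y z⟩
  have hucP : ∀ᶠ k in F, c < u (P k).fst (P k).snd := by
    rw [stPoint_fst, stPoint_snd] at huP
    exact huP.eventually (lt_mem_nhds hc)
  have hkey : ∀ᶠ k : ℕ in F, θ * (kf + 1) * g (Q k).fst (Q k).snd ≤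
      (1 + ‖a (Q k).fst (Q k).snd‖) * ‖G k + H k‖ +
      (κ + 1) * (‖(G k).snd‖ * (‖(P k).snd - (Q k).snd‖ + 1 / (k + 1))) +
      (κ + 1) ^ 2 / 2 * ((k + 1) * (‖(P k).snd - (Q k).snd‖ + 1 / (k + 1)) ^ 2) +
      ε * frob (σm (P k).fst (P k).snd) ^ 2 + θ * g t x / 4 +
      kf * (|u (P k).fst (P k).snd - v (Q k).fst (Q k).snd| +
        (κ + 1) * (‖(G k).snd‖ * (‖(P k).snd - (Q k).snd‖ + 1 / (k + 1))) +
        frob (σm (Q k).fst (Q k).snd) * ‖G k + H k‖) := by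
    filter_upwards [hP'.eventually hnear, hQ'.eventually hnear, hucP] with k hPk hQk hck
    obtain ⟨hPt, hPx, hPM, hPf⟩ := hPk
    obtain ⟨hQt, hQx, -, hQf⟩ := hQk
    have hP₀ := hu.jet_le hPt hPx (hPM.trans_lt hck) (hjP k)
    have hQ₀ := hv.jet_le hg θ hQt hQx (hjQ k)
    obtain ⟨hgL, hgS, hgt⟩ := hgb _ (Ico_subset_Icc_self hQt) (Q k).snd
    set e : ℝ := ‖(P k).snd - (Q k).snd‖ + 1 / (k + 1) with he
    have hN : (0 : ℝ) < 1 / (k + 1) := by positivity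
    have hcoef := coeff_sub_le (haσLip _ (Ico_subset_Icc_self hQt) (P k).snd (Q k).snd)
      (hωb k _ (Ico_subset_Icc_self hPt) _ (Ico_subset_Icc_self hQt) (htime k) _ hPx.le)
    have hcoef' := hcoef.trans (show _ ≤ (κ + 1) * e by
      rw [he]
      nlinarith [norm_nonneg ((P k).snd - (Q k).snd), mul_nonneg hκ hN.le])
    have hsum := jetOp_add_le (G := G k) (H := H k) (by positivity : (0 : ℝ) ≤ k + 1) hcoef'
      (hAB k)
    have hgrad := norm_transMulVec_sub_le (σm (P k).fst (P k).snd) (σm (Q k).fst (Q k).snd)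
      (G k).snd (H k).snd (θ • sigGrad σm g (Q k).fst (Q k).snd)
    rw [norm_smul, Real.norm_of_nonneg hθ.le] at hgrad
    set z₁ := transMulVec (σm (P k).fst (P k).snd) (G k).snd
    set z₂ := -transMulVec (σm (Q k).fst (Q k).snd) (H k).snd -
      θ • sigGrad σm g (Q k).fst (Q k).snd
    have hgrad' : ‖z₁ - z₂‖ ≤ (κ + 1) * (‖(G k).snd‖ * e) +
        frob (σm (Q k).fst (Q k).snd) * ‖G k + H k‖ + θ * (C₁ * g (Q k).fst (Q k).snd) := by
      refine hgrad.trans (add_le_add (add_le_add ?_ ?_) (mul_le_mul_of_nonneg_left hgS hθ.le))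
      · rw [mul_left_comm, mul_comm]
        refine mul_le_mul_of_nonneg_left ?_ (norm_nonneg _)
        linarith [norm_nonneg (a (P k).fst (P k).snd - a (Q k).fst (Q k).snd)]
      · refine mul_le_mul_of_nonneg_left ?_ (frob_nonneg _)
        exact norm_snd_le_norm (G k + H k)
    have hf₁ := (abs_le.1 (hPf (u (P k).fst (P k).snd) z₁)).2
    have hf₂ := (abs_le.1 (hQf (v (Q k).fst (Q k).snd) z₂)).1
    have hf₃ := (abs_le.1 (hfLip t hp.1 x (v (Q k).fst (Q k).snd) (u (P k).fst (P k).snd)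
      z₂ z₁)).2
    have hf₄ := mul_le_mul_of_nonneg_left hgrad' hkf
    have hgL' := mul_le_mul_of_nonneg_left hgL hθ.le
    rw [hgt] at hQ₀
    linarith
  have hlim := le_of_tendsto_of_tendsto (hgQ.const_mul (θ * (kf + 1)))
    ((((((tendsto_const_nhds.add haQ.norm).mul hS).add (hX₁.const_mul (κ + 1))).add
      (hX₂.const_mul ((κ + 1) ^ 2 / 2))).add ((hσP.pow 2).const_mul ε)).add_const
      (θ * g t x / 4) |>.add (((huv.add (hX₁.const_mul (κ + 1))).add (hσQ.mul hS)).const_mul kf))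
    hkey
  have hεb : ε * frob (σm t x) ^ 2 ≤ θ * g t x / 4 := by
    rw [hε, div_mul_eq_mul_div, div_le_iff₀ (by positivity)]
    nlinarith [sq_nonneg (frob (σm t x))]
  simp only [mul_zero, add_zero, zero_add] at hlim
  linarith

end Comparison

/-- **Comparison principle.** With a local driver, if `v` is a viscosity
supersolution and `u` a viscosity subsolution of the QVI, and `u, v ∈ Π^g`, then `u ≤ v`
on `[0,T] × ℝ^n`. -/
theorem qvi_comparison_principle
    (n d : ℕ) (hn : 0 < n) (hd : 0 < d) (T : ℝ) (hT : 0 < T)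
    (U : Type) [MetricSpace U] [CompactSpace U] [Nonempty U]
    (Γ : ℝ → En n → U → En n) (ℓ : ℝ → En n → U → ℝ)
    (a : ℝ → En n → En n) (σm : ℝ → En n → Matrix (Fin n) (Fin d) ℝ)
    (f : ℝ → En n → ℝ → Ed d → ℝ) (ψ : En n → ℝ)
    (KΓ δ Cf kf Cψ Cℓ qℓ Caσ kaσ ρ : ℝ)
    (hKΓ : 0 < KΓ) (hδ : 0 < δ) (hρ : 0 < ρ)
    (hCf : 0 < Cf) (hkf : 0 < kf) (hCψ : 0 < Cψ) (hCℓ : 0 < Cℓ) (hqℓ : 0 < qℓ)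
    (hCaσ : 0 < Caσ) (hkaσ : 0 < kaσ)
    -- assumptions on Γ
    (hΓc : ContinuousOn (fun p : ℝ × En n × U => Γ p.1 p.2.1 p.2.2)
      (Icc 0 T ×ˢ (univ : Set (En n × U))))
    (hΓb : ∀ t ∈ Icc (0:ℝ) T, ∀ (x : En n) (b : U), ‖Γ t x b‖ ≤ max KΓ ‖x‖)
    -- assumptions on ℓ
    (hℓc : ContinuousOn (fun p : ℝ × En n × U => ℓ p.1 p.2.1 p.2.2)
      (Icc 0 T ×ˢ (univ : Set (En n × U))))
    (hℓlb : ∀ t ∈ Icc (0:ℝ) T, ∀ (x : En n) (b : U), δ ≤ ℓ t x b)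
    (hℓg : ∀ t ∈ Icc (0:ℝ) T, ∀ (x : En n) (b : U), |ℓ t x b| ≤ Cℓ * (1 + ‖x‖ ^ qℓ))
    -- assumptions on ψ
    (hψc : Continuous ψ)
    (hψg : ∀ x : En n, |ψ x| ≤ Cψ * (1 + ‖x‖ ^ ρ))
    (hψΓ : ∀ (x : En n) (b : U), ψ (Γ T x b) - ℓ T x b < ψ x)
    -- assumptions on a and σ
    (hac : ContinuousOn (fun p : ℝ × En n => a p.1 p.2) (Strip n T))
    (hσc : ContinuousOn (fun p : ℝ × En n => σm p.1 p.2) (Strip n T))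
    (haσg : ∀ t ∈ Icc (0:ℝ) T, ∀ x : En n, ‖a t x‖ + frob (σm t x) ≤ Caσ * (1 + ‖x‖))
    (haσLip : ∀ t ∈ Icc (0:ℝ) T, ∀ x x' : En n,
      ‖a t x - a t x'‖ + frob (σm t x - σm t x') ≤ kaσ * ‖x - x'‖)
    -- assumptions on the local driver f
    (hfc : ∀ ε > (0:ℝ), ∀ p ∈ Strip n T, ∃ δ' > (0:ℝ),
      ∀ q ∈ Strip n T, dist q p ≤ δ' → ∀ (y : ℝ) (z : Ed d),
        |f q.1 q.2 y z - f p.1 p.2 y z| ≤ ε)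
    (hfLip : ∀ t ∈ Icc (0:ℝ) T, ∀ (x : En n) (y y' : ℝ) (z z' : Ed d),
      |f t x y' z' - f t x y z| ≤ kf * (|y' - y| + ‖z' - z‖))
    (hfg : ∀ t ∈ Icc (0:ℝ) T, ∀ x : En n, |f t x 0 0| ≤ Cf * (1 + ‖x‖ ^ ρ))
    -- u, v in Π^g, supersolution and subsolution
    (u v : ℝ → En n → ℝ)
    (hupg : PolyGrowth T u) (hvpg : PolyGrowth T v)
    (hv : IsSuper T Γ ℓ a σm f ψ v) (hu : IsSub T Γ ℓ a σm f ψ u) :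
    ∀ t ∈ Icc (0:ℝ) T, ∀ x : En n, u t x ≤ v t x := by
  by_contra! hcon
  obtain ⟨t₀, ht₀, x₀, hlt⟩ := hcon
  obtain ⟨Cu, hCu, ρu, -, hub⟩ := hupg
  obtain ⟨Cv, hCv, ρv, -, hvb⟩ := id hvpg
  obtain ⟨g, C₁, hC₁, hg, hg0, hgm, hgR, hgb⟩ :=
    exists_weight (n := n) (d := d) KΓ T (max ρu ρv) kf hCaσ.le hkf.le
  have hgc : Continuous fun p : ℝ × En n => g p.1 p.2 := hg.continuous
  have husc : UpperSemicontinuousOn (fun p : ℝ × En n => u p.1 p.2 - v p.1 p.2) (Strip n T) := by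
    simpa only [sub_eq_add_neg, Pi.neg_apply] using hu.1.add hv.1.neg
  obtain ⟨θ, hθ, hle, Z, hZ, hZne, hZiff⟩ := exists_ratio_max husc hgc.continuousOn
    (fun p _ => hg0 p.1 p.2) (fun θ hθ => by
      obtain ⟨Ru, hRu⟩ := hgR ρu (le_max_left _ _) Cu hCu.le (θ / 4) (by positivity)
      obtain ⟨Rv, hRv⟩ := hgR ρv (le_max_right _ _) Cv hCv.le (θ / 4) (by positivity)
      refine ⟨Icc 0 T ×ˢ Metric.closedBall 0 (max Ru Rv),
        prod_mono Subset.rfl (subset_univ _), isCompact_Icc.prod (isCompact_closedBall _ _),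
        fun p hp hpB => ?_⟩
      have hpR : max Ru Rv < ‖p.2‖ := by
        by_contra! h
        exact hpB ⟨hp.1, mem_closedBall_zero_iff.2 h⟩
      have h1 := hRu p.1 hp.1 p.2 ((le_max_left _ _).trans hpR.le)
      have h2 := hRv p.1 hp.1 p.2 ((le_max_right _ _).trans hpR.le)
      have h3 := (abs_le.1 (hub p.1 hp.1 p.2)).2
      have h4 := (abs_le.1 (hvb p.1 hp.1 p.2)).1
      have h5 := mul_pos hθ (hg0 p.1 p.2)
      linarith)
    (show (t₀, x₀) ∈ Strip n T from ⟨ht₀, mem_univ _⟩) (sub_pos.2 hlt)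
  obtain ⟨p, hp, hpT, heq, hM⟩ := exists_contact_mop_lt hv hu hvpg hδ hΓc hΓb hℓc hℓlb hg0 hgm hθ
    hle hZ hZne hZiff
  exact not_contact_of_mop_lt hkf.le hkaσ.le hΓc hℓc hac hσc haσLip hfc hfLip hv hu hg hg0
    (fun t ht x => hgb a σm t x (haσg t ht x)) hθ hle ⟨hp.1.1, hpT⟩ heq hM
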